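/- arXiv:2504.21824 — 2 statements merged into one kernel-verified Lean document; each statement's English description precedes it below -/
import Mathlib

section
/- Let α be a nonnegative integer and let h ∈ C_c^∞((0,2)) satisfy, for every s ∈ (0,1), ∫_0^{1-s} t^{1-2α} h(t) ([(1+t)^2-s^2][(1-t)^2-s^2])^{α-1/2} dt = ∫_{1+s}^{2} t^{1-2α} h(t) ([(1+t)^2-s^2][(1-t)^2-s^2])^{α-1/2} dt. Then for every λ > 0 with J_α(λ) = 0, one has ∫_0^2 t^{1-α} h(t) J_α(λ t) dt = 0. -/
/-- Bessel function of the first kind of integer order `α`: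
`J_α(x) = Σ_{k≥0} (-1)^k (x/2)^{2k+α} / (k! (k+α)!)`. -/
noncomputable def besselJ (α : ℕ) (x : ℝ) : ℝ :=
  ∑' k : ℕ, (-1 : ℝ) ^ k * (x / 2) ^ (2 * k + α) /
    ((Nat.factorial k : ℝ) * (Nat.factorial (k + α) : ℝ))

/-- The entire function `z ↦ ∑ zᵏ / (k! (k + n)!)`, which carries the Bessel function `J_n`. -/
noncomputable def besselSeries (n : ℕ) (z : ℝ) : ℝ :=
  ∑' k : ℕ, z ^ k / ((Nat.factorial k : ℝ) * (Nat.factorial (k + n) : ℝ))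

lemma norm_besselSeries_term_le (n k : ℕ) {z r : ℝ} (hz : |z| ≤ r) :
    ‖z ^ k / ((Nat.factorial k : ℝ) * (Nat.factorial (k + n) : ℝ))‖ ≤
      r ^ k / (Nat.factorial k : ℝ) := by
  have h1 : (1 : ℝ) ≤ (Nat.factorial (k + n) : ℝ) := by
    exact_mod_cast Nat.factorial_pos (k + n)
  have h2 : (0 : ℝ) < (Nat.factorial k : ℝ) := by exact_mod_cast Nat.factorial_pos k
  have h3 : |z| ^ k ≤ r ^ k := pow_le_pow_left₀ (abs_nonneg z) hz k
  rw [Real.norm_eq_abs, abs_div, abs_pow, abs_of_pos (by positivity :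
    (0 : ℝ) < (Nat.factorial k : ℝ) * (Nat.factorial (k + n) : ℝ))]
  apply div_le_div₀ ((pow_nonneg (abs_nonneg z) k).trans h3) h3 h2
  nlinarith

lemma summable_besselSeries (n : ℕ) (z : ℝ) :
    Summable fun k : ℕ => z ^ k / ((Nat.factorial k : ℝ) * (Nat.factorial (k + n) : ℝ)) :=
  Summable.of_norm_bounded (Real.summable_pow_div_factorial |z|)
    fun k => norm_besselSeries_term_le n k le_rfl

lemma besselSeries_zero_right (n : ℕ) : besselSeries n 0 = 1 / (Nat.factorial n : ℝ) := by
  rw [besselSeries, tsum_eq_single 0 (by intro b hb; simp [hb])]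
  simp

lemma besselSeries_term_succ (n k : ℕ) (z : ℝ) :
    ((k + 1 : ℕ) : ℝ) * z ^ k /
        ((Nat.factorial (k + 1) : ℝ) * (Nat.factorial (k + 1 + n) : ℝ)) =
      z ^ k / ((Nat.factorial k : ℝ) * (Nat.factorial (k + (n + 1)) : ℝ)) := by
  have h2 : (0 : ℝ) < (Nat.factorial k : ℝ) := by exact_mod_cast Nat.factorial_pos k
  have h1 : (0 : ℝ) < (Nat.factorial (k + (n + 1)) : ℝ) := by
    exact_mod_cast Nat.factorial_pos _
  rw [show k + 1 + n = k + (n + 1) by ring, Nat.factorial_succ k]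
  push_cast
  field_simp

lemma hasDerivAt_besselSeries (n : ℕ) (z : ℝ) :
    HasDerivAt (besselSeries n) (besselSeries (n + 1) z) z := by
  set r : ℝ := |z| + 1 with hr
  have key := hasDerivAt_tsum_of_isPreconnected
    (g := fun (k : ℕ) (y : ℝ) => y ^ k / ((Nat.factorial k : ℝ) * (Nat.factorial (k + n) : ℝ)))
    (g' := fun (k : ℕ) (y : ℝ) =>
      (k : ℝ) * y ^ (k - 1) / ((Nat.factorial k : ℝ) * (Nat.factorial (k + n) : ℝ)))
    (u := fun k : ℕ => (k : ℝ) * r ^ (k - 1) / (Nat.factorial k : ℝ))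
    (t := Metric.ball 0 r) (y₀ := z) (y := z) ?_ Metric.isOpen_ball
    (convex_ball (0 : ℝ) r).isPreconnected ?_ ?_ ?_ (summable_besselSeries n z) ?_
  · have hs : Summable fun k : ℕ =>
        (k : ℝ) * z ^ (k - 1) / ((Nat.factorial k : ℝ) * (Nat.factorial (k + n) : ℝ)) := by
      rw [← summable_nat_add_iff 1]
      refine (summable_besselSeries (n + 1) z).congr fun k => ?_
      exact (besselSeries_term_succ n k z).symm
    convert! key using 1
    rw [hs.tsum_eq_zero_add, besselSeries]
    simp only [Nat.cast_zero, zero_mul, zero_div, zero_add, Nat.add_sub_cancel]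
    exact tsum_congr fun k => (besselSeries_term_succ n k z).symm
  · rw [← summable_nat_add_iff 1]
    refine (Real.summable_pow_div_factorial r).congr fun k => ?_
    have h2 : (0 : ℝ) < (Nat.factorial k : ℝ) := by exact_mod_cast Nat.factorial_pos k
    rw [Nat.factorial_succ k]
    push_cast
    field_simp
  · intro k y _
    exact (hasDerivAt_pow k y).div_const _
  · intro k y hy
    have hy' : |y| ≤ r := by
      have := mem_ball_zero_iff.mp hy
      rw [Real.norm_eq_abs] at this
      exact this.le
    have h1 : (1 : ℝ) ≤ (Nat.factorial (k + n) : ℝ) := by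
      exact_mod_cast Nat.factorial_pos (k + n)
    have h2 : (0 : ℝ) < (Nat.factorial k : ℝ) := by exact_mod_cast Nat.factorial_pos k
    have h3 : |y| ^ (k - 1) ≤ r ^ (k - 1) := pow_le_pow_left₀ (abs_nonneg y) hy' _
    rw [Real.norm_eq_abs, abs_div, abs_mul, abs_pow, Nat.abs_cast, abs_of_pos (by positivity :
      (0 : ℝ) < (Nat.factorial k : ℝ) * (Nat.factorial (k + n) : ℝ))]
    have h4 : (k : ℝ) * |y| ^ (k - 1) ≤ k * r ^ (k - 1) := by gcongr
    apply div_le_div₀ ((by positivity : 0 ≤ (k : ℝ) * |y| ^ (k - 1)).trans h4) h4 h2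
    nlinarith
  all_goals
    rw [mem_ball_zero_iff, Real.norm_eq_abs, hr]
    linarith

lemma continuous_besselSeries (n : ℕ) : Continuous (besselSeries n) :=
  continuous_iff_continuousAt.2 fun z => (hasDerivAt_besselSeries n z).continuousAt

lemma besselSeries_recurrence (n : ℕ) (z : ℝ) :
    z * besselSeries (n + 2) z + (n + 1) * besselSeries (n + 1) z = besselSeries n z := by
  have hs : Summable fun k : ℕ => (k : ℝ) * z ^ k /
      ((Nat.factorial k : ℝ) * (Nat.factorial (k + (n + 1)) : ℝ)) := by
    rw [← summable_nat_add_iff 1]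
    refine ((summable_besselSeries (n + 2) z).mul_left z).congr fun k => ?_
    rw [← besselSeries_term_succ (n + 1) k z]
    ring
  have h1 : z * besselSeries (n + 2) z = ∑' k : ℕ, (k : ℝ) * z ^ k /
      ((Nat.factorial k : ℝ) * (Nat.factorial (k + (n + 1)) : ℝ)) := by
    rw [hs.tsum_eq_zero_add, besselSeries, ← tsum_mul_left]
    simp only [Nat.cast_zero, zero_mul, zero_div, zero_add]
    refine tsum_congr fun k => ?_
    rw [← besselSeries_term_succ (n + 1) k z]
    ring
  rw [h1, besselSeries, besselSeries, ← tsum_mul_left,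
    ← hs.tsum_add ((summable_besselSeries (n + 1) z).mul_left _)]
  refine tsum_congr fun k => ?_
  have h2 : (0 : ℝ) < (Nat.factorial k : ℝ) := by exact_mod_cast Nat.factorial_pos k
  have h1 : (0 : ℝ) < (Nat.factorial (k + n) : ℝ) := by
    exact_mod_cast Nat.factorial_pos _
  rw [show k + (n + 1) = k + n + 1 by ring, Nat.factorial_succ (k + n)]
  push_cast
  field_simp
  ring

lemma besselJ_eq_besselSeries (n : ℕ) (x : ℝ) :
    besselJ n x = (x / 2) ^ n * besselSeries n (-(x / 2) ^ 2) := by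
  rw [besselJ, besselSeries, ← tsum_mul_left]
  refine tsum_congr fun k => ?_
  rw [neg_pow ((x / 2) ^ 2) k, pow_add, pow_mul]
  ring

/-- `τ ↦ J_n(c e^τ)` and its logarithmic derivative, expressed through `besselSeries`. -/
lemma exists_hasDerivAt_besselJ_exp (n : ℕ) (c : ℝ) :
    ∃ y' : ℝ → ℝ, ∀ τ : ℝ,
      HasDerivAt (fun τ => besselJ n (c * Real.exp τ)) (y' τ) τ ∧
      HasDerivAt y' (((n : ℝ) ^ 2 - c ^ 2 * Real.exp τ ^ 2) * besselJ n (c * Real.exp τ)) τ := by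
  set u : ℝ → ℝ := fun τ => c * Real.exp τ / 2 with hu
  have hud : ∀ τ, HasDerivAt u (u τ) τ := fun τ =>
    ((Real.hasDerivAt_exp τ).const_mul c).div_const 2
  have hB : ∀ m τ, HasDerivAt (fun τ => besselSeries m (-(u τ) ^ 2))
      (besselSeries (m + 1) (-(u τ) ^ 2) * (-(2 * u τ * u τ))) τ := by
    intro m τ
    have := (hasDerivAt_besselSeries m (-(u τ) ^ 2)).comp τ ((hud τ).fun_pow 2).fun_neg
    convert! this using 1
    simp
  have hp : ∀ m : ℕ, ∀ τ, HasDerivAt (fun τ => u τ ^ m) (m * u τ ^ m) τ := by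
    intro m τ
    convert! (hud τ).fun_pow m using 1
    rcases m with _ | m
    · simp
    · rw [Nat.add_sub_cancel]; ring
  refine ⟨fun τ => n * (u τ ^ n * besselSeries n (-(u τ) ^ 2)) -
    2 * (u τ ^ (n + 2) * besselSeries (n + 1) (-(u τ) ^ 2)), fun τ => ⟨?_, ?_⟩⟩
  · have h := (hp n τ).fun_mul (hB n τ)
    have e : (fun τ => besselJ n (c * Real.exp τ)) =
        fun τ => u τ ^ n * besselSeries n (-(u τ) ^ 2) :=
      funext fun τ => besselJ_eq_besselSeries n _
    rw [e]
    convert! h using 1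
    ring
  · have h := (((hp n τ).fun_mul (hB n τ)).const_mul (n : ℝ)).fun_sub
      (((hp (n + 2) τ).fun_mul (hB (n + 1) τ)).const_mul (2 : ℝ))
    convert! h using 1
    rw [besselJ_eq_besselSeries n, ← besselSeries_recurrence n,
      show c * Real.exp τ / 2 = u τ from rfl,
      show c ^ 2 * Real.exp τ ^ 2 = 4 * u τ ^ 2 by simp only [hu]; ring]
    push_cast
    ring

lemma hasDerivAt_intervalIntegral_param {G G' : ℝ → ℝ → ℝ}
    (hG : Continuous (Function.uncurry G)) (hG' : Continuous (Function.uncurry G'))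
    (hd : ∀ x y, HasDerivAt (fun x => G x y) (G' x y) x) (x : ℝ) :
    HasDerivAt (fun x => ∫ y in (0 : ℝ)..x, G x y) (G x x + ∫ y in (0 : ℝ)..x, G' x y) x := by
  have hGx : ∀ x, Continuous (G x) := fun x => hG.comp (Continuous.prodMk_right x)
  have hG'x : ∀ x, Continuous (G' x) := fun x => hG'.comp (Continuous.prodMk_right x)
  have h1 : HasDerivAt (fun z => ∫ y in (0 : ℝ)..x, G z y) (∫ y in (0 : ℝ)..x, G' x y) x := by
    obtain ⟨C, hC⟩ := ((isCompact_closedBall x 1).prod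
      (isCompact_uIcc (a := (0 : ℝ)) (b := x))).exists_bound_of_continuousOn hG'.continuousOn
    refine (intervalIntegral.hasDerivAt_integral_of_dominated_loc_of_deriv_le
      (bound := fun _ => C) (Metric.closedBall_mem_nhds x one_pos)
      (Filter.Eventually.of_forall fun z => (hGx z).aestronglyMeasurable)
      ((hGx x).intervalIntegrable _ _) (hG'x x).aestronglyMeasurable
      (Filter.Eventually.of_forall fun y hy z hz => ?_) intervalIntegrable_const
      (Filter.Eventually.of_forall fun y _ z _ => hd z y)).2
    exact hC (z, y) ⟨hz, Set.uIoc_subset_uIcc hy⟩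
  have h2 : HasDerivAt (fun z => ∫ y in x..z, G z y) (G x x) x := by
    rw [hasDerivAt_iff_isLittleO, Asymptotics.isLittleO_iff]
    intro c hc
    obtain ⟨δ, hδ, hball⟩ := Metric.continuousAt_iff.1
      (hG.continuousAt (x := (x, x))) c hc
    filter_upwards [Metric.ball_mem_nhds x hδ] with z hz
    rw [intervalIntegral.integral_same, sub_zero, smul_eq_mul,
      ← smul_eq_mul, ← intervalIntegral.integral_const,
      ← intervalIntegral.integral_sub ((hGx z).intervalIntegrable _ _) intervalIntegrable_const]
    refine intervalIntegral.norm_integral_le_of_norm_le_const fun y hy => ?_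
    have hyz : dist y x < δ := by
      have h3 : |y - x| ≤ |z - x| := Set.abs_sub_left_of_mem_uIcc (Set.uIoc_subset_uIcc hy)
      rw [Real.dist_eq]
      rw [Metric.mem_ball, Real.dist_eq] at hz
      linarith
    have := hball (x := (z, y)) (by
      rw [Prod.dist_eq]
      exact max_lt (Metric.mem_ball.1 hz) hyz)
    rw [dist_eq_norm] at this
    exact this.le
  have h3 := h2.fun_add h1
  refine h3.congr_of_eventuallyEq (Filter.Eventually.of_forall fun z => ?_)
  have := intervalIntegral.integral_add_adjacent_intervals
    ((hGx z).intervalIntegrable (μ := MeasureTheory.volume) 0 x) ((hGx z).intervalIntegrable x z)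
  simp only
  rw [← this]
  ring

/-- Integral of the Riemann function `J_0(2√(-c w))`, `w = 1 + e^{2τ} - 2 e^τ cosh ψ`, against
`cosh (n ψ)`; a solution of the Bessel equation in the variable `τ` vanishing at `τ = 0`. -/
noncomputable def crossIntegral (n : ℕ) (c τ : ℝ) : ℝ :=
  ∫ ψ in (0 : ℝ)..τ,
    besselSeries 0 (c * (1 + Real.exp τ ^ 2 - 2 * Real.exp τ * Real.cosh ψ)) * Real.cosh (n * ψ)

lemma exists_hasDerivAt_crossIntegral (n : ℕ) (c : ℝ) :
    ∃ y' : ℝ → ℝ, y' 0 = 1 ∧ ∀ τ : ℝ,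
      HasDerivAt (crossIntegral n c) (y' τ) τ ∧
      HasDerivAt y' (((n : ℝ) ^ 2 + 4 * c * Real.exp τ ^ 2) * crossIntegral n c τ) τ := by
  set w : ℝ → ℝ → ℝ :=
    fun τ ψ => c * (1 + Real.exp τ ^ 2 - 2 * Real.exp τ * Real.cosh ψ) with hw
  set w₁ : ℝ → ℝ → ℝ :=
    fun τ ψ => c * (2 * Real.exp τ ^ 2 - 2 * Real.exp τ * Real.cosh ψ) with hw₁
  set w₂ : ℝ → ℝ → ℝ :=
    fun τ ψ => c * (4 * Real.exp τ ^ 2 - 2 * Real.exp τ * Real.cosh ψ) with hw₂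
  set v : ℝ → ℝ → ℝ := fun τ ψ => c * (-2 * Real.exp τ * Real.sinh ψ) with hv
  have hwτ : ∀ τ ψ, HasDerivAt (fun τ => w τ ψ) (w₁ τ ψ) τ := by
    intro τ ψ
    have he := Real.hasDerivAt_exp τ
    convert! ((((he.fun_pow 2).const_add 1).fun_sub
      ((he.const_mul 2).mul_const (Real.cosh ψ))).const_mul c) using 1
    simp only [hw₁]; push_cast; ring
  have hw₁τ : ∀ τ ψ, HasDerivAt (fun τ => w₁ τ ψ) (w₂ τ ψ) τ := by
    intro τ ψ
    have he := Real.hasDerivAt_exp τ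
    convert! ((((he.fun_pow 2).const_mul 2).fun_sub
      ((he.const_mul 2).mul_const (Real.cosh ψ))).const_mul c) using 1
    simp only [hw₂]; push_cast; ring
  have hwψ : ∀ τ ψ, HasDerivAt (fun ψ => w τ ψ) (v τ ψ) ψ := by
    intro τ ψ
    convert! (((Real.hasDerivAt_cosh ψ).const_mul (2 * Real.exp τ)).const_sub
      (1 + Real.exp τ ^ 2)).const_mul c using 1
    simp only [hv]; ring
  have hvψ : ∀ τ ψ, HasDerivAt (fun ψ => v τ ψ)
      (c * (-2 * Real.exp τ * Real.cosh ψ)) ψ := by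
    intro τ ψ
    exact ((Real.hasDerivAt_sinh ψ).const_mul (-2 * Real.exp τ)).const_mul c
  have hBτ : ∀ m τ ψ, HasDerivAt (fun τ => besselSeries m (w τ ψ))
      (besselSeries (m + 1) (w τ ψ) * w₁ τ ψ) τ :=
    fun m τ ψ => HasDerivAt.comp (h₂ := besselSeries m) (h := fun τ => w τ ψ) τ
      (hasDerivAt_besselSeries m (w τ ψ)) (hwτ τ ψ)
  have hBψ : ∀ m τ ψ, HasDerivAt (fun ψ => besselSeries m (w τ ψ))
      (besselSeries (m + 1) (w τ ψ) * v τ ψ) ψ :=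
    fun m τ ψ => HasDerivAt.comp (h₂ := besselSeries m) (h := fun ψ => w τ ψ) ψ
      (hasDerivAt_besselSeries m (w τ ψ)) (hwψ τ ψ)
  have hc : ∀ ψ, HasDerivAt (fun ψ => Real.cosh (n * ψ)) (n * Real.sinh (n * ψ)) ψ := by
    intro ψ
    convert! (Real.hasDerivAt_cosh (n * ψ)).comp ψ ((hasDerivAt_id ψ).const_mul (n : ℝ)) using 1
    simp; ring
  have hs : ∀ ψ, HasDerivAt (fun ψ => Real.sinh (n * ψ)) (n * Real.cosh (n * ψ)) ψ := by
    intro ψ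
    convert! (Real.hasDerivAt_sinh (n * ψ)).comp ψ ((hasDerivAt_id ψ).const_mul (n : ℝ)) using 1
    simp; ring
  have cB := continuous_besselSeries
  have cB' : ∀ m, Continuous fun p : ℝ × ℝ => besselSeries m (w p.1 p.2) := fun m =>
    (cB m).comp (by fun_prop)
  set G₀ : ℝ → ℝ → ℝ := fun τ ψ => besselSeries 0 (w τ ψ) * Real.cosh (n * ψ) with hG₀
  set G₁ : ℝ → ℝ → ℝ := fun τ ψ => besselSeries 1 (w τ ψ) * w₁ τ ψ * Real.cosh (n * ψ) with hG₁
  set G₂ : ℝ → ℝ → ℝ := fun τ ψ =>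
    (besselSeries 2 (w τ ψ) * w₁ τ ψ * w₁ τ ψ + besselSeries 1 (w τ ψ) * w₂ τ ψ) *
      Real.cosh (n * ψ) with hG₂
  have cG₀ : Continuous (Function.uncurry G₀) := by
    have := cB' 0
    unfold Function.uncurry; simp only [hG₀]; fun_prop
  have cG₁ : Continuous (Function.uncurry G₁) := by
    have := cB' 1
    unfold Function.uncurry; simp only [hG₁, hw₁]; fun_prop
  have cG₂ : Continuous (Function.uncurry G₂) := by
    have := cB' 1
    have := cB' 2
    unfold Function.uncurry; simp only [hG₂, hw₁, hw₂]; fun_prop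
  have d0 := hasDerivAt_intervalIntegral_param cG₀ cG₁
    (fun τ ψ => (hBτ 0 τ ψ).mul_const _)
  have d1 := hasDerivAt_intervalIntegral_param cG₁ cG₂
    (fun τ ψ => ((hBτ 1 τ ψ).fun_mul (hw₁τ τ ψ)).mul_const _)
  have hdiag : ∀ τ, w τ τ = 0 := by
    intro τ
    have : Real.exp τ * Real.exp (-τ) = 1 := by rw [← Real.exp_add]; simp
    simp only [hw, Real.cosh_eq]; linear_combination (-c) * this
  have hdiag₁ : ∀ τ, w₁ τ τ + v τ τ = 0 := by
    intro τ
    simp only [hw₁, hv, Real.cosh_eq, Real.sinh_eq]; ring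
  have hB0 : ∀ τ, besselSeries 0 (w τ τ) = 1 := fun τ => by
    rw [hdiag, besselSeries_zero_right]; simp
  refine ⟨fun τ => Real.cosh (n * τ) + ∫ ψ in (0 : ℝ)..τ, G₁ τ ψ, by simp, fun τ => ⟨?_, ?_⟩⟩
  · have := d0 τ
    rw [show G₀ τ τ = Real.cosh (n * τ) by simp only [hG₀, hB0, one_mul]] at this
    exact this
  · convert! (hc τ).fun_add (d1 τ) using 1
    set T : ℝ → ℝ := fun ψ => besselSeries 1 (w τ ψ) * v τ ψ * Real.cosh (n * ψ) -
      n * (besselSeries 0 (w τ ψ) * Real.sinh (n * ψ)) with hT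
    have dT : ∀ ψ, HasDerivAt T
        (G₂ τ ψ - ((n : ℝ) ^ 2 + 4 * c * Real.exp τ ^ 2) * G₀ τ ψ) ψ := by
      intro ψ
      convert! (((hBψ 1 τ ψ).fun_mul (hvψ τ ψ)).fun_mul (hc ψ)).fun_sub
        (((hBψ 0 τ ψ).fun_mul (hs ψ)).const_mul (n : ℝ)) using 1
      simp only [hG₀, hG₂]
      have hr := besselSeries_recurrence 0 (w τ ψ)
      have hcs := Real.cosh_sq ψ
      have hq : w₁ τ ψ * w₁ τ ψ - v τ ψ * v τ ψ = 4 * c * Real.exp τ ^ 2 * w τ ψ := by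
        simp only [hw, hw₁, hv]
        linear_combination 4 * c ^ 2 * Real.exp τ ^ 2 * hcs
      have hq2 : w₂ τ ψ - c * (-2 * Real.exp τ * Real.cosh ψ) = 4 * c * Real.exp τ ^ 2 := by
        simp only [hw₂]; ring
      rw [← hr]
      simp only [zero_add, Nat.cast_zero, one_mul]
      linear_combination besselSeries 2 (w τ ψ) * Real.cosh (n * ψ) * hq +
        besselSeries 1 (w τ ψ) * Real.cosh (n * ψ) * hq2
    have i0 : IntervalIntegrable (G₀ τ) MeasureTheory.volume 0 τ :=
      (cG₀.comp (Continuous.prodMk_right τ)).intervalIntegrable _ _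
    have i2 : IntervalIntegrable (G₂ τ) MeasureTheory.volume 0 τ :=
      (cG₂.comp (Continuous.prodMk_right τ)).intervalIntegrable _ _
    have key := intervalIntegral.integral_eq_sub_of_hasDerivAt (a := 0) (b := τ)
      (fun ψ _ => dT ψ) (i2.sub (i0.const_mul _))
    rw [intervalIntegral.integral_sub i2 (i0.const_mul _),
      intervalIntegral.integral_const_mul] at key
    have hT0 : T 0 = 0 := by simp [hT, hv]
    have hTτ : T τ + G₁ τ τ = - n * Real.sinh (n * τ) := by
      simp only [hT, hG₁, hB0]
      linear_combination besselSeries 1 (w τ τ) * Real.cosh (n * τ) * hdiag₁ τ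
    change _ * (∫ ψ in (0 : ℝ)..τ, G₀ τ ψ) = _
    linear_combination -key - hTτ + hT0

lemma eq_mul_of_second_order_linear {V f f' g g' : ℝ → ℝ} (hV : Continuous V)
    (hf : ∀ t, HasDerivAt f (f' t) t ∧ HasDerivAt f' (V t * f t) t)
    (hg : ∀ t, HasDerivAt g (g' t) t ∧ HasDerivAt g' (V t * g t) t)
    (hf0 : f 0 = 0) (hg0 : g 0 = 0) (hg1 : g' 0 = 1) (t : ℝ) : f t = f' 0 * g t := by
  set N : ℝ := |t| + 1 with hN
  obtain ⟨C, hC⟩ := (isCompact_Icc (a := -N) (b := N)).exists_bound_of_continuousOn hV.continuousOn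
  have hC0 : 0 ≤ C :=
    (norm_nonneg _).trans (hC 0 ⟨by simp only [hN]; linarith [abs_nonneg t], by positivity⟩)
  have key := ODE_solution_unique_of_mem_Ioo (a := -N) (b := N) (t₀ := 0)
    (K := ⟨1 + C, by positivity⟩) (s := fun _ => Set.univ)
    (v := fun t (p : ℝ × ℝ) => (p.2, V t * p.1))
    (f := fun t => (f t, f' t)) (g := fun t => (f' 0 * g t, f' 0 * g' t))
    ?_ ⟨by simp only [hN]; linarith [abs_nonneg t], by positivity⟩
    (fun t _ => ⟨(hf t).1.prodMk (hf t).2, trivial⟩) (fun t _ => ⟨?_, trivial⟩) ?_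
  · have := key (x := t) ⟨by simp only [hN]; linarith [neg_abs_le t],
      by simp only [hN]; linarith [le_abs_self t]⟩
    exact congrArg Prod.fst this
  · intro t ht
    refine LipschitzOnWith.of_dist_le_mul fun p _ q _ => ?_
    have hVt : |V t| ≤ C := hC t (Set.Ioo_subset_Icc_self ht)
    rw [dist_eq_norm, dist_eq_norm, Prod.mk_sub_mk, Prod.norm_mk, ← mul_sub]
    have h1 := norm_fst_le (p - q)
    have h2 := norm_snd_le (p - q)
    change _ ≤ (1 + C) * _
    have h0 := norm_nonneg (p - q)
    rw [Prod.fst_sub] at h1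
    rw [Prod.snd_sub] at h2
    refine max_le (by nlinarith) ?_
    rw [norm_mul, Real.norm_eq_abs (V t)]
    calc |V t| * ‖p.1 - q.1‖ ≤ C * ‖p - q‖ := by gcongr
      _ ≤ (1 + C) * ‖p - q‖ := by linarith
  · have := ((hg t).1.const_mul (f' 0)).prodMk ((hg t).2.const_mul (f' 0))
    convert! this using 2
    ring
  · simp [hf0, hg0, hg1]

lemma exists_besselJ_eq_mul_crossIntegral (n : ℕ) {c : ℝ} (hc : besselJ n c = 0) :
    ∃ C : ℝ, ∀ τ : ℝ,
      besselJ n (c * Real.exp τ) = C * crossIntegral n (-(c / 2) ^ 2) τ := by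
  obtain ⟨f', hf⟩ := exists_hasDerivAt_besselJ_exp n c
  obtain ⟨g', hg1, hg⟩ := exists_hasDerivAt_crossIntegral n (-(c / 2) ^ 2)
  refine ⟨f' 0, eq_mul_of_second_order_linear
    (V := fun τ => (n : ℝ) ^ 2 - c ^ 2 * Real.exp τ ^ 2) (by fun_prop) hf
    (fun τ => ⟨(hg τ).1, ?_⟩) (by simpa using hc) (by simp [crossIntegral]) hg1⟩
  convert! (hg τ).2 using 1
  ring

/-- A locally integrable profile on the line that lives on `(1, ∞)` and is continuous there. -/
structure IsProfile (q : ℝ → ℝ) : Prop where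
  measurable : Measurable q
  eq_zero : ∀ x ≤ 1, q x = 0
  intervalIntegrable : ∀ a b, IntervalIntegrable q MeasureTheory.volume a b
  continuousOn : ContinuousOn q (Set.Ioi 1)

/-- The primitive vanishing at `1`. -/
noncomputable def primitiveOne (q : ℝ → ℝ) (x : ℝ) : ℝ := ∫ y in (1 : ℝ)..x, q y

namespace IsProfile

variable {q r : ℝ → ℝ}

lemma continuous_primitiveOne (hq : IsProfile q) : Continuous (primitiveOne q) :=
  intervalIntegral.continuous_primitive hq.intervalIntegrable 1

lemma integral_eq_primitiveOne (hq : IsProfile q) {a : ℝ} (ha : a ≤ 1) (x : ℝ) :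
    ∫ y in a..x, q y = primitiveOne q x := by
  rw [primitiveOne, ← intervalIntegral.integral_add_adjacent_intervals
    (hq.intervalIntegrable a 1) (hq.intervalIntegrable 1 x), add_eq_right]
  refine (intervalIntegral.integral_congr fun y hy => ?_).trans intervalIntegral.integral_zero
  rw [Set.uIcc_of_le ha] at hy
  exact hq.eq_zero y hy.2

lemma primitive (hq : IsProfile q) : IsProfile (primitiveOne q) where
  measurable := hq.continuous_primitiveOne.measurable
  eq_zero x hx := by
    rw [← hq.integral_eq_primitiveOne hx, intervalIntegral.integral_same]
  intervalIntegrable := hq.continuous_primitiveOne.intervalIntegrable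
  continuousOn := hq.continuous_primitiveOne.continuousOn

lemma iterate_primitiveOne (hq : IsProfile q) (n : ℕ) : IsProfile (primitiveOne^[n] q) := by
  induction n with
  | zero => exact hq
  | succ n ih => rw [Function.iterate_succ_apply']; exact ih.primitive

lemma id_mul (hq : IsProfile q) : IsProfile fun x => x * q x where
  measurable := measurable_id.mul hq.measurable
  eq_zero x hx := by rw [hq.eq_zero x hx, mul_zero]
  intervalIntegrable a b := (hq.intervalIntegrable a b).continuousOn_mul continuousOn_id
  continuousOn := continuousOn_id.mul hq.continuousOn

lemma const_mul (hq : IsProfile q) (c : ℝ) : IsProfile fun x => c * q x where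
  measurable := hq.measurable.const_mul c
  eq_zero x hx := by rw [hq.eq_zero x hx, mul_zero]
  intervalIntegrable a b := (hq.intervalIntegrable a b).const_mul c
  continuousOn := continuousOn_const.mul hq.continuousOn

lemma add (hq : IsProfile q) (hr : IsProfile r) : IsProfile fun x => q x + r x where
  measurable := hq.measurable.add hr.measurable
  eq_zero x hx := by rw [hq.eq_zero x hx, hr.eq_zero x hx, add_zero]
  intervalIntegrable a b := (hq.intervalIntegrable a b).add (hr.intervalIntegrable a b)
  continuousOn := hq.continuousOn.add hr.continuousOn

lemma primitiveOne_add (hq : IsProfile q) (hr : IsProfile r) :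
    primitiveOne (fun x => q x + r x) =
      fun x => primitiveOne q x + primitiveOne r x :=
  funext fun _ => intervalIntegral.integral_add (hq.intervalIntegrable _ _)
    (hr.intervalIntegrable _ _)

lemma iterate_primitiveOne_add (hq : IsProfile q) (hr : IsProfile r) (n : ℕ) :
    primitiveOne^[n] (fun x => q x + r x) =
      fun x => primitiveOne^[n] q x + primitiveOne^[n] r x := by
  induction n with
  | zero => rfl
  | succ n ih =>
    simp only [Function.iterate_succ_apply', ih]
    exact (hq.iterate_primitiveOne n).primitiveOne_add (hr.iterate_primitiveOne n)

lemma primitiveOne_id_mul (hq : IsProfile q) :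
    primitiveOne (fun x => x * q x) =
      fun x => x * primitiveOne q x + (-1) * primitiveOne (primitiveOne q) x := by
  funext x
  rcases le_or_gt x 1 with hx | hx
  · rw [hq.id_mul.primitive.eq_zero x hx, hq.primitive.eq_zero x hx,
      hq.primitive.primitive.eq_zero x hx]
    ring
  · have h := intervalIntegral.integral_mul_deriv_eq_deriv_mul_of_hasDerivAt
      (a := 1) (b := x) (u := fun y => y) (v := primitiveOne q) (u' := fun _ => 1) (v' := q)
      continuousOn_id hq.continuous_primitiveOne.continuousOn (fun y _ => hasDerivAt_id y)
      (fun y hy => ?_) intervalIntegrable_const (hq.intervalIntegrable _ _)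
    · rw [hq.primitive.eq_zero 1 le_rfl] at h
      simp only [one_mul] at h
      rw [primitiveOne, h, primitiveOne.eq_def (primitiveOne q)]
      ring
    · rw [min_eq_left hx.le] at hy
      have hmem : Set.Ioi (1 : ℝ) ∈ nhds y := Ioi_mem_nhds hy.1
      exact intervalIntegral.integral_hasDerivAt_right (hq.intervalIntegrable _ _)
        (hq.measurable.stronglyMeasurable.stronglyMeasurableAtFilter)
        (hq.continuousOn.continuousAt hmem)

end IsProfile

lemma primitiveOne_const_mul (c : ℝ) (q : ℝ → ℝ) :
    primitiveOne (fun x => c * q x) = fun x => c * primitiveOne q x :=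
  funext fun _ => intervalIntegral.integral_const_mul c q

lemma iterate_primitiveOne_const_mul (c : ℝ) (q : ℝ → ℝ) (n : ℕ) :
    primitiveOne^[n] (fun x => c * q x) = fun x => c * primitiveOne^[n] q x := by
  induction n with
  | zero => rfl
  | succ n ih => simp only [Function.iterate_succ_apply', ih, primitiveOne_const_mul]

lemma IsProfile.iterate_primitiveOne_id_mul {q : ℝ → ℝ} (hq : IsProfile q) (n : ℕ) :
    primitiveOne^[n] (fun x => x * q x) =
      fun x => x * primitiveOne^[n] q x + (-(n : ℝ)) * primitiveOne^[n + 1] q x := by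
  induction n with
  | zero => simp
  | succ n ih =>
    have h := hq.iterate_primitiveOne n
    rw [Function.iterate_succ_apply', ih, IsProfile.primitiveOne_add h.id_mul
      ((hq.iterate_primitiveOne (n + 1)).const_mul _), h.primitiveOne_id_mul,
      primitiveOne_const_mul]
    funext x
    simp only [Function.iterate_succ_apply']
    push_cast
    ring

/-- `T_n(x) / √(x² - 1)` for `x > 1`, where `T_n` is the Chebyshev polynomial. -/
noncomputable def chebyshevProfile (n : ℕ) (x : ℝ) : ℝ :=
  if 1 < x then Real.cosh (n * Real.arcosh x) * (√(x ^ 2 - 1))⁻¹ else 0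

/-- `(x² - 1)^{n - 1/2}` for `x > 1`. -/
noncomputable def gegenbauerProfile (n : ℕ) (x : ℝ) : ℝ :=
  if 1 < x then (x ^ 2 - 1) ^ ((n : ℝ) - 1 / 2) else 0

lemma isProfile_chebyshevProfile (n : ℕ) : IsProfile (chebyshevProfile n) := by
  have hc : ContinuousOn (fun x : ℝ => Real.cosh (n * Real.arcosh x)) (Set.Ici 1) :=
    Real.continuous_cosh.comp_continuousOn (continuousOn_const.mul Real.continuousOn_arcosh)
  have hco : ContinuousOn (chebyshevProfile n) (Set.Ioi 1) := by
    have h1 : ContinuousOn (fun x : ℝ => Real.cosh (n * Real.arcosh x) * (√(x ^ 2 - 1))⁻¹)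
        (Set.Ioi 1) := by
      refine (hc.mono Set.Ioi_subset_Ici_self).mul
        (ContinuousOn.inv₀ (by fun_prop) fun x hx => ?_)
      have : (1 : ℝ) < x := hx
      exact (Real.sqrt_pos.2 (by nlinarith)).ne'
    exact h1.congr fun x hx => if_pos hx
  have hint : ∀ b, 1 ≤ b → IntervalIntegrable (chebyshevProfile n) MeasureTheory.volume 1 b := by
    intro b hb
    have h1 : IntervalIntegrable (fun x : ℝ => (√(x ^ 2 - 1))⁻¹) MeasureTheory.volume 1 b := by
      refine intervalIntegral.intervalIntegrable_deriv_of_nonneg (g := Real.arcosh) ?_ ?_ ?_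
      · rw [Set.uIcc_of_le hb]
        exact Real.continuousOn_arcosh.mono Set.Icc_subset_Ici_self
      · intro x hx
        rw [min_eq_left hb] at hx
        exact Real.hasDerivAt_arcosh hx.1
      · intro x _; positivity
    have h2 := h1.continuousOn_mul (g := fun x : ℝ => Real.cosh (n * Real.arcosh x)) (by
      rw [Set.uIcc_of_le hb]
      exact hc.mono Set.Icc_subset_Ici_self)
    refine h2.congr fun x hx => ?_
    rw [Set.uIoc_of_le hb] at hx
    exact (if_pos hx.1).symm
  have hint0 : ∀ b, b ≤ 1 → IntervalIntegrable (chebyshevProfile n) MeasureTheory.volume 1 b := by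
    intro b hb
    refine (intervalIntegrable_const (c := (0 : ℝ))).congr fun x hx => ?_
    rw [Set.uIoc_of_ge hb] at hx
    exact (if_neg hx.2.not_gt).symm
  have hint1 : ∀ b, IntervalIntegrable (chebyshevProfile n) MeasureTheory.volume 1 b := fun b =>
    (le_total 1 b).elim (hint b) (hint0 b)
  refine ⟨?_, fun x hx => if_neg hx.not_gt, fun a b => (hint1 a).symm.trans (hint1 b), hco⟩
  have hm : Measurable Real.arcosh := by unfold Real.arcosh; fun_prop
  unfold chebyshevProfile
  exact Measurable.ite measurableSet_Ioi (by fun_prop) measurable_const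

lemma mul_primitiveOne_chebyshevProfile (n : ℕ) {x : ℝ} (hx : 1 < x) :
    n * primitiveOne (chebyshevProfile n) x = Real.sinh (n * Real.arcosh x) := by
  have hp := isProfile_chebyshevProfile n
  have h := intervalIntegral.integral_eq_sub_of_hasDerivAt_of_le
    (f := fun x => Real.sinh (n * Real.arcosh x)) (f' := fun x => n * chebyshevProfile n x)
    hx.le ?_ ?_ ((hp.intervalIntegrable 1 x).const_mul (n : ℝ))
  · rw [intervalIntegral.integral_const_mul] at h
    simpa [Real.arcosh_zero, primitiveOne] using h
  · exact Real.continuous_sinh.comp_continuousOn (continuousOn_const.mul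
      (Real.continuousOn_arcosh.mono Set.Icc_subset_Ici_self))
  · intro y hy
    convert! (Real.hasDerivAt_sinh (n * Real.arcosh y)).comp y
      ((Real.hasDerivAt_arcosh hy.1).const_mul (n : ℝ)) using 1
    rw [chebyshevProfile, if_pos hy.1]
    ring

lemma chebyshevProfile_succ (n : ℕ) :
    chebyshevProfile (n + 1) = fun x =>
      x * chebyshevProfile n x + n * primitiveOne (chebyshevProfile n) x := by
  funext x
  rcases le_or_gt x 1 with hx | hx
  · have hp := isProfile_chebyshevProfile n
    rw [(isProfile_chebyshevProfile (n + 1)).eq_zero x hx, hp.eq_zero x hx,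
      hp.primitive.eq_zero x hx]
    ring
  · have h1 : 0 < √(x ^ 2 - 1) := Real.sqrt_pos.2 (by nlinarith)
    rw [mul_primitiveOne_chebyshevProfile n hx, chebyshevProfile, chebyshevProfile, if_pos hx,
      if_pos hx]
    push_cast
    rw [add_mul, one_mul, Real.cosh_add, Real.cosh_arcosh hx.le, Real.sinh_arcosh hx.le]
    field_simp

lemma primitiveOne_id_mul_gegenbauerProfile (n : ℕ) (hn : IsProfile (gegenbauerProfile n)) :
    primitiveOne (fun x => x * gegenbauerProfile n x) =
      fun x => (2 * (n : ℝ) + 1)⁻¹ * gegenbauerProfile (n + 1) x := by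
  funext x
  rcases le_or_gt x 1 with hx | hx
  · rw [hn.id_mul.primitive.eq_zero x hx, gegenbauerProfile, if_neg hx.not_gt, mul_zero]
  · have hexp : (0 : ℝ) < (n : ℝ) + 1 / 2 := by positivity
    have h := intervalIntegral.integral_eq_sub_of_hasDerivAt_of_le
      (f := fun x : ℝ => (2 * (n : ℝ) + 1)⁻¹ * (x ^ 2 - 1) ^ ((n : ℝ) + 1 / 2))
      (f' := fun x => x * gegenbauerProfile n x)
      hx.le ?_ ?_ (hn.id_mul.intervalIntegrable 1 x)
    · rw [primitiveOne, h, gegenbauerProfile, if_pos hx]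
      push_cast
      rw [show (n : ℝ) + 1 - 1 / 2 = n + 1 / 2 by ring]
      norm_num [Real.zero_rpow hexp.ne']
    · exact continuousOn_const.mul (ContinuousOn.rpow_const (by fun_prop)
        fun y _ => Or.inr hexp.le)
    · intro y hy
      have hy1 : 0 < y ^ 2 - 1 := by nlinarith [hy.1]
      have hd := ((((hasDerivAt_id y).fun_pow 2).sub_const 1).rpow_const
        (p := (n : ℝ) + 1 / 2) (Or.inl hy1.ne')).const_mul (2 * (n : ℝ) + 1)⁻¹
      convert! hd using 1
      rw [gegenbauerProfile, if_pos hy.1, show (n : ℝ) + 1 / 2 - 1 = n - 1 / 2 by ring]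
      simp only [id]
      field_simp
      push_cast
      ring

/-- Rodrigues' formula for the Chebyshev polynomials, in integrated form. -/
lemma exists_iterate_primitiveOne_chebyshevProfile (n : ℕ) :
    ∃ c : ℝ, c ≠ 0 ∧
      primitiveOne^[n] (chebyshevProfile n) = fun x => c * gegenbauerProfile n x := by
  induction n with
  | zero =>
    refine ⟨1, one_ne_zero, funext fun x => ?_⟩
    rw [Function.iterate_zero, id, chebyshevProfile, gegenbauerProfile]
    split_ifs with hx
    · have : 0 ≤ x ^ 2 - 1 := by nlinarith
      rw [Real.sqrt_eq_rpow, ← Real.rpow_neg this]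
      simp
    · simp
  | succ n ih =>
    obtain ⟨c, hc, ih⟩ := ih
    have hp := isProfile_chebyshevProfile n
    have hg : IsProfile (gegenbauerProfile n) := by
      have := (hp.iterate_primitiveOne n).const_mul c⁻¹
      rw [ih] at this
      simpa [hc] using this
    refine ⟨c * (2 * (n : ℝ) + 1)⁻¹, by positivity, ?_⟩
    have h1 : primitiveOne^[n] (chebyshevProfile (n + 1)) =
        fun x => c * (x * gegenbauerProfile n x) := by
      rw [chebyshevProfile_succ, hp.id_mul.iterate_primitiveOne_add (hp.primitive.const_mul _),
        hp.iterate_primitiveOne_id_mul, iterate_primitiveOne_const_mul, ih,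
        Function.iterate_succ_apply]
      funext x
      ring
    rw [Function.iterate_succ_apply', h1, primitiveOne_const_mul,
      primitiveOne_id_mul_gegenbauerProfile n hg]
    funext x
    ring

lemma IsProfile.continuous_mul {q φ : ℝ → ℝ} (hq : IsProfile q) (hφ : Continuous φ) :
    IsProfile fun x => φ x * q x where
  measurable := hφ.measurable.mul hq.measurable
  eq_zero x hx := by rw [hq.eq_zero x hx, mul_zero]
  intervalIntegrable a b := (hq.intervalIntegrable a b).continuousOn_mul hφ.continuousOn
  continuousOn := hφ.continuousOn.mul hq.continuousOn

lemma IsProfile.abs {q : ℝ → ℝ} (hq : IsProfile q) : IsProfile fun x => |q x| where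
  measurable := hq.measurable.abs
  eq_zero x hx := by rw [hq.eq_zero x hx, abs_zero]
  intervalIntegrable a b := (hq.intervalIntegrable a b).abs
  continuousOn := hq.continuousOn.abs

/-- The hyperbolic law of cosines: `cosh ψ` for `v = 1 + t² - 2 t cosh ψ`. -/
noncomputable def hypCos (t v : ℝ) : ℝ := (1 + t ^ 2 - v) / (2 * t)

lemma hypCos_eq_sub (t v : ℝ) : hypCos t v = hypCos t 0 - v / (2 * t) := by
  simp only [hypCos]; ring

lemma measurable_hypCos : Measurable (Function.uncurry hypCos) := by
  unfold Function.uncurry hypCos; fun_prop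

lemma hypCos_one_le {t : ℝ} (ht : 0 < t) (ht2 : t ≤ 2) : hypCos t 1 ≤ 1 := by
  rw [hypCos, div_le_one (by positivity)]
  nlinarith

lemma IsProfile.intervalIntegrable_hypCos {q : ℝ → ℝ} (hq : IsProfile q) {t : ℝ} (ht : 0 < t)
    (a b : ℝ) : IntervalIntegrable (fun v => q (hypCos t v)) MeasureTheory.volume a b := by
  have h1 := ((hq.intervalIntegrable (hypCos t a) (hypCos t b)).comp_sub_left
    (hypCos t 0)).comp_mul_left (c := (2 * t)⁻¹)
  convert h1 using 1
  · funext v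
    rw [hypCos_eq_sub]
    congr 1
    ring
  all_goals
    rw [hypCos, hypCos]
    field_simp
    ring

lemma IsProfile.integral_mul_hypCos {q φ : ℝ → ℝ} (hq : IsProfile q) (hφ : Continuous φ)
    {t : ℝ} (ht : 0 < t) (ht2 : t ≤ 2) (w : ℝ) :
    ∫ v in w..1, φ v * q (hypCos t v) =
      2 * t * primitiveOne (fun x => φ (1 + t ^ 2 - 2 * t * x) * q x) (hypCos t w) := by
  have hf : IsProfile fun x => φ (1 + t ^ 2 - 2 * t * x) * q x :=
    hq.continuous_mul (hφ.comp (by fun_prop))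
  have h := intervalIntegral.integral_comp_sub_div (a := w) (b := 1)
    (fun x => φ (1 + t ^ 2 - 2 * t * x) * q x) (c := 2 * t) (by positivity) (hypCos t 0)
  rw [← hypCos_eq_sub, ← hypCos_eq_sub, hf.integral_eq_primitiveOne (hypCos_one_le ht ht2),
    smul_eq_mul] at h
  rw [← h]
  refine intervalIntegral.integral_congr fun v _ => ?_
  simp only [← hypCos_eq_sub]
  congr 2
  rw [hypCos]
  field_simp
  ring

open MeasureTheory in
lemma IsProfile.integrable_prod_hypCos {q φ k : ℝ → ℝ} (hq : IsProfile q) (hφ : Continuous φ)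
    {ε w : ℝ} (hε : 0 < ε) (hw : 0 ≤ w) (hw1 : w ≤ 1) (hk : IntegrableOn k (Set.Ioc ε 2)) :
    Integrable (fun p : ℝ × ℝ => φ p.2 * (k p.1 * q (hypCos p.1 p.2)))
      ((volume.restrict (Set.Ioc ε 2)).prod (volume.restrict (Set.Ioc w 1))) := by
  set μ := (volume : Measure ℝ).restrict (Set.Ioc ε 2) with hμ
  set ν := (volume : Measure ℝ).restrict (Set.Ioc w 1) with hν
  have hkq : Integrable (fun p : ℝ × ℝ => k p.1 * q (hypCos p.1 p.2)) (μ.prod ν) := by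
    have hmeas : AEStronglyMeasurable (fun p : ℝ × ℝ => k p.1 * q (hypCos p.1 p.2))
        (μ.prod ν) :=
      hk.aestronglyMeasurable.comp_fst.mul
        (hq.measurable.comp measurable_hypCos).aestronglyMeasurable
    rw [integrable_prod_iff hmeas]
    have hae : ∀ᵐ t ∂μ, t ∈ Set.Ioc ε 2 := ae_restrict_mem measurableSet_Ioc
    constructor
    · filter_upwards [hae] with t ht
      exact (((hq.intervalIntegrable_hypCos (hε.trans ht.1) w 1)).1).const_mul (k t)
    · set M := 2 * 2 * primitiveOne (fun x => |q x|) (5 / (2 * ε)) with hM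
      refine (hk.norm.mul_const M).mono' hmeas.norm.integral_prod_right' ?_
      filter_upwards [hae] with t ht
      have ht0 : 0 < t := hε.trans ht.1
      have h1 := hq.abs.integral_mul_hypCos (φ := fun _ => 1) continuous_const ht0 ht.2 w
      simp only [one_mul] at h1
      rw [intervalIntegral.integral_of_le hw1] at h1
      simp only [norm_mul, Real.norm_eq_abs]
      rw [integral_const_mul, h1, abs_of_nonneg (by
        rw [← h1]
        exact mul_nonneg (abs_nonneg _) (integral_nonneg fun v => abs_nonneg _))]
      refine mul_le_mul_of_nonneg_left ?_ (abs_nonneg _)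
      have hle : hypCos t w ≤ 5 / (2 * ε) := by
        rw [hypCos]
        have := ht.2
        apply div_le_div₀ (by norm_num) (by nlinarith) (by positivity) (by linarith [ht.1])
      have hmono : ∀ x, x ≤ 5 / (2 * ε) → primitiveOne (fun x => |q x|) x ≤
          primitiveOne (fun x => |q x|) (5 / (2 * ε)) := by
        intro x hx
        rw [← sub_nonneg, primitiveOne, primitiveOne,
          intervalIntegral.integral_interval_sub_left (hq.abs.intervalIntegrable _ _)
            (hq.abs.intervalIntegrable _ _)]
        exact intervalIntegral.integral_nonneg hx fun _ _ => abs_nonneg _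
      have h0 : 0 ≤ primitiveOne (fun x => |q x|) (hypCos t w) := by
        by_contra hneg
        have : 0 ≤ ∫ v in Set.Ioc w 1, |q (hypCos t v)| := integral_nonneg fun _ => abs_nonneg _
        rw [h1] at this
        nlinarith
      exact mul_le_mul (by linarith [ht.2]) (hmono _ hle) h0 (by norm_num)
  obtain ⟨C, hC⟩ := (isCompact_Icc (a := w) (b := 1)).exists_bound_of_continuousOn
    hφ.continuousOn
  refine hkq.bdd_mul (c := C) (hφ.comp continuous_snd).aestronglyMeasurable ?_
  have hae : ∀ᵐ v ∂ν, v ∈ Set.Ioc w 1 := ae_restrict_mem measurableSet_Ioc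
  filter_upwards [Measure.quasiMeasurePreserving_snd.ae hae] with p hp
  exact hC _ (Set.Ioc_subset_Icc_self hp)

/-- The kernel transform with profile `q` of a density `k` supported in `(ε, 2]`. -/
noncomputable def profileTransform (ε : ℝ) (q k : ℝ → ℝ) (v : ℝ) : ℝ :=
  ∫ t in Set.Ioc ε 2, k t * q (hypCos t v)

open MeasureTheory in
lemma IsProfile.integrableOn_profileTransform {q k : ℝ → ℝ} (hq : IsProfile q) {ε : ℝ}
    (hε : 0 < ε) (hk : IntegrableOn k (Set.Ioc ε 2)) :
    IntegrableOn (profileTransform ε q k) (Set.Ioc 0 1) := by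
  have := (hq.integrable_prod_hypCos (φ := fun _ => 1) continuous_const hε le_rfl zero_le_one
    hk).integral_prod_right
  simp only [one_mul] at this
  exact this

open MeasureTheory in
lemma IsProfile.integral_mul_profileTransform {q φ k : ℝ → ℝ} (hq : IsProfile q)
    (hφ : Continuous φ) {ε w : ℝ} (hε : 0 < ε) (hw : 0 ≤ w) (hw1 : w ≤ 1)
    (hk : IntegrableOn k (Set.Ioc ε 2)) :
    ∫ v in w..1, φ v * profileTransform ε q k v =
      ∫ t in Set.Ioc ε 2, k t * (2 * t *
        primitiveOne (fun x => φ (1 + t ^ 2 - 2 * t * x) * q x) (hypCos t w)) := by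
  have h := integral_integral_swap (f := fun t v => φ v * (k t * q (hypCos t v)))
    (hq.integrable_prod_hypCos hφ hε hw hw1 hk)
  simp only [integral_const_mul] at h
  rw [intervalIntegral.integral_of_le hw1]
  simp only [profileTransform]
  rw [← h]
  refine setIntegral_congr_fun measurableSet_Ioc fun t ht => ?_
  rw [← hq.integral_mul_hypCos hφ (hε.trans ht.1) ht.2 w, intervalIntegral.integral_of_le hw1,
    ← integral_const_mul]
  congr 1
  funext v
  ring

open MeasureTheory in
lemma integrableOn_div_two_mul {k : ℝ → ℝ} {ε : ℝ} (hε : 0 < ε)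
    (hk : IntegrableOn k (Set.Ioc ε 2)) : IntegrableOn (fun t => k t / (2 * t)) (Set.Ioc ε 2) := by
  have h : Integrable (fun t => (2 * t)⁻¹ * k t) (volume.restrict (Set.Ioc ε 2)) := by
    refine Integrable.bdd_mul (c := (2 * ε)⁻¹) hk (by fun_prop : Measurable fun t : ℝ =>
      (2 * t)⁻¹).aestronglyMeasurable ?_
    filter_upwards [ae_restrict_mem measurableSet_Ioc] with t ht
    have := ht.1
    have ht0 : 0 < t := hε.trans ht.1
    rw [norm_inv, Real.norm_of_nonneg (by positivity)]
    gcongr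
  refine h.congr (Filter.Eventually.of_forall fun t => ?_)
  simp only
  ring

open MeasureTheory in
lemma IsProfile.ae_profileTransform_eq_zero_of_primitiveOne {q k : ℝ → ℝ} (hq : IsProfile q)
    {ε : ℝ} (hε : 0 < ε) (hk : IntegrableOn k (Set.Ioc ε 2))
    (h : ∀ᵐ w ∂volume.restrict (Set.Ioo (0 : ℝ) 1), profileTransform ε (primitiveOne q) k w = 0) :
    ∀ᵐ w ∂volume.restrict (Set.Ioo (0 : ℝ) 1),
      profileTransform ε q (fun t => k t / (2 * t)) w = 0 := by
  have hk' := integrableOn_div_two_mul hε hk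
  set F := profileTransform ε q (fun t => k t / (2 * t)) with hF
  have hFi : IntervalIntegrable F volume 0 1 :=
    (intervalIntegrable_iff_integrableOn_Ioc_of_le zero_le_one).2
      (hq.integrableOn_profileTransform hε hk')
  have hFint : ∀ w ∈ Set.Ioo (0 : ℝ) 1,
      ∫ v in w..1, F v = profileTransform ε (primitiveOne q) k w := by
    intro w hw
    have h1 := hq.integral_mul_profileTransform (φ := fun _ => 1) continuous_const hε hw.1.le
      hw.2.le hk'
    simp only [one_mul] at h1
    rw [h1, profileTransform]
    refine setIntegral_congr_fun measurableSet_Ioc fun t ht => ?_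
    have ht0 : 0 < t := hε.trans ht.1
    field_simp
  have hzero : Set.EqOn (fun w => ∫ v in (1 : ℝ)..w, F v) (fun _ => 0) (Set.Ioo 0 1) := by
    refine Measure.eqOn_open_of_ae_eq (μ := volume) ?_ isOpen_Ioo ?_ continuousOn_const
    · filter_upwards [h, ae_restrict_mem measurableSet_Ioo] with w hw hwm
      rw [intervalIntegral.integral_symm, hFint w hwm, hw, neg_zero]
    · have hI : IntegrableOn F (Set.uIcc 1 0) volume := by
        rw [Set.uIcc_of_ge zero_le_one, integrableOn_Icc_iff_integrableOn_Ioc]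
        exact hFi.1
      refine (intervalIntegral.continuousOn_primitive_interval hI).mono ?_
      rw [Set.uIcc_of_ge zero_le_one]
      exact Set.Ioo_subset_Icc_self
  filter_upwards [ae_restrict_of_ae hFi.ae_hasDerivAt_integral,
    ae_restrict_mem measurableSet_Ioo] with w hw hwm
  have hd := hw (by rw [Set.uIcc_of_le zero_le_one]; exact Set.Ioo_subset_Icc_self hwm) 1
    Set.right_mem_uIcc
  refine hd.unique ((hasDerivAt_const w (0 : ℝ)).congr_of_eventuallyEq ?_)
  exact hzero.eventuallyEq_of_mem (Ioo_mem_nhds hwm.1 hwm.2)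

open MeasureTheory in
lemma IsProfile.ae_profileTransform_eq_zero_of_iterate {q k : ℝ → ℝ} (hq : IsProfile q)
    {ε : ℝ} (hε : 0 < ε) (n : ℕ) (hk : IntegrableOn k (Set.Ioc ε 2))
    (h : ∀ᵐ w ∂volume.restrict (Set.Ioo (0 : ℝ) 1),
      profileTransform ε (primitiveOne^[n] q) k w = 0) :
    IntegrableOn (fun t => k t / (2 * t) ^ n) (Set.Ioc ε 2) ∧
    ∀ᵐ w ∂volume.restrict (Set.Ioo (0 : ℝ) 1),
      profileTransform ε q (fun t => k t / (2 * t) ^ n) w = 0 := by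
  induction n generalizing k with
  | zero =>
    simp only [pow_zero, div_one]
    exact ⟨hk, h⟩
  | succ n ih =>
    rw [Function.iterate_succ_apply'] at h
    have := ih (integrableOn_div_two_mul hε hk)
      ((hq.iterate_primitiveOne n).ae_profileTransform_eq_zero_of_primitiveOne hε hk h)
    simpa only [div_div, ← pow_succ'] using this

lemma primitiveOne_mul_chebyshevProfile {g : ℝ → ℝ} (hg : Continuous g) (n : ℕ) {y : ℝ}
    (hy : 0 ≤ y) : primitiveOne (fun x => g x * chebyshevProfile n x) (Real.cosh y) =
      ∫ ψ in (0 : ℝ)..y, g (Real.cosh ψ) * Real.cosh (n * ψ) := by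
  have hc : Continuous fun ψ => g (Real.cosh ψ) * Real.cosh (n * ψ) := by fun_prop
  have hF : ∀ y, HasDerivAt (fun y => ∫ ψ in (0 : ℝ)..y, g (Real.cosh ψ) * Real.cosh (n * ψ))
      (g (Real.cosh y) * Real.cosh (n * y)) y :=
    fun y => (hc.integral_hasStrictDerivAt 0 y).hasDerivAt
  have h := intervalIntegral.integral_eq_sub_of_hasDerivAt_of_le
    (f := fun x => ∫ ψ in (0 : ℝ)..Real.arcosh x, g (Real.cosh ψ) * Real.cosh (n * ψ))
    (f' := fun x => g x * chebyshevProfile n x)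
    (Real.one_le_cosh y) ?_ ?_
    (((isProfile_chebyshevProfile n).continuous_mul hg).intervalIntegrable _ _)
  · rw [primitiveOne, h, Real.arcosh_cosh hy, Real.arcosh_zero, intervalIntegral.integral_same,
      sub_zero]
  · exact (continuous_iff_continuousAt.2 fun y => (hF y).continuousAt).comp_continuousOn
      (Real.continuousOn_arcosh.mono Set.Icc_subset_Ici_self)
  · intro x hx
    convert! (hF (Real.arcosh x)).comp x (Real.hasDerivAt_arcosh hx.1) using 1
    rw [chebyshevProfile, if_pos hx.1, Real.cosh_arcosh hx.1.le]
    ring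

lemma primitiveOne_chebyshevProfile_eq_crossIntegral (n : ℕ) (c : ℝ) {t : ℝ} (ht : 0 < t) :
    primitiveOne (fun x => besselSeries 0 (c * (1 + t ^ 2 - 2 * t * x)) * chebyshevProfile n x)
      (hypCos t 0) = (if t < 1 then -1 else 1) * crossIntegral n c (Real.log t) := by
  have hcosh : hypCos t 0 = Real.cosh |Real.log t| := by
    rw [Real.cosh_abs, Real.cosh_eq, Real.exp_neg, Real.exp_log ht, hypCos]
    field_simp
    ring
  rw [hcosh, primitiveOne_mul_chebyshevProfile
    (g := fun x => besselSeries 0 (c * (1 + t ^ 2 - 2 * t * x)))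
    ((continuous_besselSeries 0).comp (by fun_prop)) n (abs_nonneg _), crossIntegral,
    Real.exp_log ht]
  split_ifs with h1
  · rw [abs_of_neg (Real.log_neg ht h1), neg_one_mul, ← intervalIntegral.integral_symm]
    have h := intervalIntegral.integral_comp_neg (a := 0) (b := -Real.log t) fun ψ =>
      besselSeries 0 (c * (1 + t ^ 2 - 2 * t * Real.cosh ψ)) * Real.cosh (n * ψ)
    simpa only [Real.cosh_neg, mul_neg, neg_neg, neg_zero] using h
  · rw [abs_of_nonneg (Real.log_nonneg (not_lt.1 h1)), one_mul]

lemma isProfile_gegenbauerProfile (n : ℕ) : IsProfile (gegenbauerProfile n) := by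
  obtain ⟨c, hc, h⟩ := exists_iterate_primitiveOne_chebyshevProfile n
  have := ((isProfile_chebyshevProfile n).iterate_primitiveOne n).const_mul c⁻¹
  rw [h] at this
  simpa [hc] using this

lemma rpow_mul_rpow_eq_gegenbauerProfile (n : ℕ) {s t : ℝ} (ht : 0 < t)
    (hx : 1 ≤ hypCos t (s ^ 2)) :
    t ^ (1 - 2 * (n : ℝ)) * (((1 + t) ^ 2 - s ^ 2) * ((1 - t) ^ 2 - s ^ 2)) ^ ((n : ℝ) - 1 / 2) =
      2 ^ (2 * (n : ℝ) - 1) * gegenbauerProfile n (hypCos t (s ^ 2)) := by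
  have hP : ((1 + t) ^ 2 - s ^ 2) * ((1 - t) ^ 2 - s ^ 2) =
      (2 * t) ^ 2 * (hypCos t (s ^ 2) ^ 2 - 1) := by
    rw [hypCos]
    field_simp
    ring
  rw [hP, gegenbauerProfile]
  split_ifs with h1
  · have h2 : 0 ≤ hypCos t (s ^ 2) ^ 2 - 1 := by nlinarith
    rw [Real.mul_rpow (by positivity) h2, ← Real.rpow_natCast_mul (by positivity),
      show ((2 : ℕ) : ℝ) * ((n : ℝ) - 1 / 2) = 2 * n - 1 by push_cast; ring,
      Real.mul_rpow zero_le_two ht.le, show 1 - 2 * (n : ℝ) = -(2 * n - 1) by ring,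
      Real.rpow_neg ht.le]
    have := (Real.rpow_pos_of_pos ht (2 * (n : ℝ) - 1)).ne'
    field_simp
  · have hn : (n : ℝ) - 1 / 2 ≠ 0 := fun h => by
      have : ((2 * n : ℕ) : ℝ) = (1 : ℕ) := by push_cast; linarith
      have := Nat.cast_injective this
      omega
    rw [le_antisymm (not_lt.1 h1) hx]
    rw [one_pow, sub_self, mul_zero, Real.zero_rpow hn, mul_zero, mul_zero]

/-- The density `h` with its sign flipped beyond `1`. -/
noncomputable def signFlip (h : ℝ → ℝ) (t : ℝ) : ℝ := if t < 1 then h t else -h t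

lemma signFlip_eq_zero {h : ℝ → ℝ} {t : ℝ} (ht : h t = 0) : signFlip h t = 0 := by
  simp [signFlip, ht]

open MeasureTheory in
lemma integrableOn_signFlip {h : ℝ → ℝ} (hh : Continuous h) (a b : ℝ) :
    IntegrableOn (signFlip h) (Set.Ioc a b) := by
  have h1 : IntegrableOn h (Set.Ioc a b) := hh.integrableOn_Ioc
  refine Integrable.mono h1 (Measurable.ite measurableSet_Iio hh.measurable
    hh.measurable.neg).aestronglyMeasurable (Filter.Eventually.of_forall fun t => ?_)
  unfold signFlip
  split_ifs <;> simp

open MeasureTheory in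
lemma profileTransform_signFlip_eq_zero {n : ℕ} {h : ℝ → ℝ} {ε s : ℝ} (hε : 0 < ε) (hε2 : ε ≤ 2)
    (hh : ∀ t ∈ Set.Ioc 0 ε, h t = 0) (hs : s ∈ Set.Ioo (0 : ℝ) 1)
    (hint : IntegrableOn (fun t => signFlip h t * gegenbauerProfile n (hypCos t (s ^ 2)))
      (Set.Ioc ε 2))
    (hrange : (∫ t in (0 : ℝ)..(1 - s), t ^ (1 - 2 * (n : ℝ)) * h t *
        ((((1 + t) ^ 2 - s ^ 2) * ((1 - t) ^ 2 - s ^ 2)) ^ ((n : ℝ) - 1 / 2))) =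
      ∫ t in (1 + s)..(2 : ℝ), t ^ (1 - 2 * (n : ℝ)) * h t *
        ((((1 + t) ^ 2 - s ^ 2) * ((1 - t) ^ 2 - s ^ 2)) ^ ((n : ℝ) - 1 / 2))) :
    profileTransform ε (gegenbauerProfile n) (signFlip h) (s ^ 2) = 0 := by
  obtain ⟨hs0, hs1⟩ := hs
  set G : ℝ → ℝ := fun t => signFlip h t * gegenbauerProfile n (hypCos t (s ^ 2)) with hG
  have hG0 : ∀ t ∈ Set.Ioc 0 ε, G t = 0 := fun t ht => by
    rw [hG]; simp only; rw [signFlip_eq_zero (hh t ht), zero_mul]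
  have hI0 : IntegrableOn G (Set.Ioc 0 ε) :=
    integrableOn_zero.congr_fun (fun t ht => (hG0 t ht).symm) measurableSet_Ioc
  have hI : IntervalIntegrable G volume 0 2 := by
    rw [intervalIntegrable_iff_integrableOn_Ioc_of_le zero_le_two,
      ← Set.Ioc_union_Ioc_eq_Ioc hε.le hε2]
    exact hI0.union hint
  have hsub : ∀ a b, 0 ≤ a → a ≤ b → b ≤ 2 → IntervalIntegrable G volume a b := by
    intro a b ha hab hb
    refine hI.mono_set ?_
    rw [Set.uIcc_of_le hab, Set.uIcc_of_le zero_le_two]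
    exact Set.Icc_subset_Icc ha hb
  have hE : profileTransform ε (gegenbauerProfile n) (signFlip h) (s ^ 2) =
      ∫ t in (0 : ℝ)..2, G t := by
    rw [← intervalIntegral.integral_add_adjacent_intervals (hsub 0 ε le_rfl hε.le hε2)
      (hsub ε 2 hε.le hε2 le_rfl), intervalIntegral.integral_of_le hε.le,
      setIntegral_congr_fun measurableSet_Ioc hG0, integral_zero, zero_add,
      intervalIntegral.integral_of_le hε2]
    rfl
  have hmid : ∫ t in (1 - s)..(1 + s), G t = 0 := by
    rw [intervalIntegral.integral_of_le (by linarith)]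
    refine setIntegral_eq_zero_of_forall_eq_zero fun t ht => ?_
    have ht0 : 0 < t := by linarith [ht.1]
    have hx : hypCos t (s ^ 2) ≤ 1 := by
      rw [hypCos, div_le_one (by positivity)]
      nlinarith [mul_nonneg (sub_nonneg.2 ht.2) (sub_nonneg.2 ht.1.le)]
    simp only [hG, (isProfile_gegenbauerProfile n).eq_zero _ hx, mul_zero]
  have hker : ∀ t, 0 < t → s ^ 2 ≤ (1 - t) ^ 2 →
      t ^ (1 - 2 * (n : ℝ)) * h t *
        ((((1 + t) ^ 2 - s ^ 2) * ((1 - t) ^ 2 - s ^ 2)) ^ ((n : ℝ) - 1 / 2)) =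
      2 ^ (2 * (n : ℝ) - 1) * (h t * gegenbauerProfile n (hypCos t (s ^ 2))) := by
    intro t ht hts
    have := rpow_mul_rpow_eq_gegenbauerProfile n (s := s) ht (by
      rw [hypCos, one_le_div (by positivity)]
      nlinarith)
    rw [mul_right_comm, this]
    ring
  have hleft : (∫ t in (0 : ℝ)..(1 - s), t ^ (1 - 2 * (n : ℝ)) * h t *
        ((((1 + t) ^ 2 - s ^ 2) * ((1 - t) ^ 2 - s ^ 2)) ^ ((n : ℝ) - 1 / 2))) =
      2 ^ (2 * (n : ℝ) - 1) * ∫ t in (0 : ℝ)..(1 - s), G t := by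
    rw [← intervalIntegral.integral_const_mul, intervalIntegral.integral_of_le (by linarith),
      intervalIntegral.integral_of_le (by linarith)]
    refine setIntegral_congr_fun measurableSet_Ioc fun t ht => ?_
    have ht1 : t < 1 := by linarith [ht.2]
    simp only [hG, signFlip, if_pos ht1]
    exact hker t ht.1 (by nlinarith [ht.2])
  have hright : (∫ t in (1 + s)..(2 : ℝ), t ^ (1 - 2 * (n : ℝ)) * h t *
        ((((1 + t) ^ 2 - s ^ 2) * ((1 - t) ^ 2 - s ^ 2)) ^ ((n : ℝ) - 1 / 2))) =
      -(2 ^ (2 * (n : ℝ) - 1) * ∫ t in (1 + s)..(2 : ℝ), G t) := by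
    rw [← intervalIntegral.integral_const_mul, ← intervalIntegral.integral_neg,
      intervalIntegral.integral_of_le (by linarith), intervalIntegral.integral_of_le (by linarith)]
    refine setIntegral_congr_fun measurableSet_Ioc fun t ht => ?_
    have ht1 : ¬t < 1 := by linarith [ht.1]
    simp only [hG, signFlip, if_neg ht1]
    rw [hker t (by linarith [ht.1]) (by nlinarith [ht.1])]
    ring
  rw [hleft, hright] at hrange
  rw [hE, ← intervalIntegral.integral_add_adjacent_intervals
    (hsub 0 (1 + s) le_rfl (by linarith) (by linarith))
    (hsub (1 + s) 2 (by linarith) (by linarith) le_rfl),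
    ← intervalIntegral.integral_add_adjacent_intervals
    (hsub 0 (1 - s) le_rfl (by linarith) (by linarith))
    (hsub (1 - s) (1 + s) (by linarith) (by linarith) (by linarith)), hmid]
  have h2 : (0 : ℝ) < 2 ^ (2 * (n : ℝ) - 1) := by positivity
  have h3 : (2 : ℝ) ^ (2 * (n : ℝ) - 1) *
      ((∫ t in (0 : ℝ)..(1 - s), G t) + 0 + ∫ t in (1 + s)..(2 : ℝ), G t) = 0 := by
    linear_combination hrange
  exact (mul_eq_zero.1 h3).resolve_left h2.ne'

/-- **Vanishing condition at the zeros of `J_α`** (consequence of the cross product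
identity).  If `h ∈ C_c^∞((0,2))` satisfies the elliptic-integral symmetry relation
for every `s ∈ (0,1)`, then for every `λ > 0` with `J_α(λ) = 0`,
`∫_0^2 t^{1-α} h(t) J_α(λt) dt = 0`. -/
theorem hankel_vanishing_at_bessel_zeros
    (α : ℕ)
    (h : ℝ → ℝ) (hsmooth : ContDiff ℝ (⊤ : ℕ∞) h)
    (hcpt : HasCompactSupport h) (hsupp : tsupport h ⊆ Set.Ioo 0 2)
    (hrange : ∀ s ∈ Set.Ioo (0 : ℝ) 1,
      (∫ t in (0 : ℝ)..(1 - s),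
          t ^ (1 - 2 * (α : ℝ)) * h t *
            ((((1 + t) ^ 2 - s ^ 2) * ((1 - t) ^ 2 - s ^ 2)) ^ ((α : ℝ) - 1 / 2)))
        = ∫ t in (1 + s)..(2 : ℝ),
            t ^ (1 - 2 * (α : ℝ)) * h t *
              ((((1 + t) ^ 2 - s ^ 2) * ((1 - t) ^ 2 - s ^ 2)) ^ ((α : ℝ) - 1 / 2))) :
    ∀ lam : ℝ, 0 < lam → besselJ α lam = 0 →
      (∫ t in (0 : ℝ)..2, t ^ (1 - (α : ℝ)) * h t * besselJ α (lam * t)) = 0 := by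
  intro lam _ hlam
  obtain ⟨ε, hε, hε2, hh0⟩ : ∃ ε > 0, ε ≤ 2 ∧ ∀ t ∈ Set.Ioc 0 ε, h t = 0 := by
    have h0 : (0 : ℝ) ∉ tsupport h := fun h0 => lt_irrefl _ (hsupp h0).1
    obtain ⟨δ, hδ, hδ0⟩ := Metric.eventually_nhds_iff.1 (notMem_tsupport_iff_eventuallyEq.1 h0)
    refine ⟨min (δ / 2) 2, by positivity, min_le_right _ _, fun t ht => hδ0 ?_⟩
    rw [Real.dist_0_eq_abs, abs_of_pos ht.1]
    linarith [ht.2.trans (min_le_left _ _)]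
  have hk := integrableOn_signFlip hsmooth.continuous ε 2
  have hg := isProfile_gegenbauerProfile α
  have hcheb := isProfile_chebyshevProfile α
  have hgeg : ∀ᵐ w ∂MeasureTheory.volume.restrict (Set.Ioo (0 : ℝ) 1),
      profileTransform ε (gegenbauerProfile α) (signFlip h) w = 0 := by
    have hint := (hg.integrable_prod_hypCos (φ := fun _ => 1) continuous_const hε le_rfl
      zero_le_one hk).prod_left_ae
    filter_upwards [MeasureTheory.ae_restrict_of_ae_restrict_of_subset Set.Ioo_subset_Ioc_self
      hint, MeasureTheory.ae_restrict_mem measurableSet_Ioo] with w hw hwm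
    simp only [one_mul] at hw
    rw [← Real.sq_sqrt hwm.1.le] at hw ⊢
    have hs : √w ∈ Set.Ioo (0 : ℝ) 1 :=
      ⟨Real.sqrt_pos.2 hwm.1, (Real.sqrt_lt' one_pos).2 (by simpa using hwm.2)⟩
    exact profileTransform_signFlip_eq_zero hε hε2 hh0 hs hw (hrange _ hs)
  obtain ⟨b, -, hb⟩ := exists_iterate_primitiveOne_chebyshevProfile α
  obtain ⟨hk', hzero⟩ := hcheb.ae_profileTransform_eq_zero_of_iterate hε α hk (by
    filter_upwards [hgeg] with w hw
    rw [profileTransform] at hw ⊢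
    simp only [hb, mul_left_comm _ b, MeasureTheory.integral_const_mul, hw, mul_zero])
  obtain ⟨C, hC⟩ := exists_besselJ_eq_mul_crossIntegral α hlam
  set c := -(lam / 2) ^ 2
  have hmain := hcheb.integral_mul_profileTransform (φ := fun v => besselSeries 0 (c * v))
    ((continuous_besselSeries 0).comp (by fun_prop)) hε le_rfl zero_le_one hk'
  rw [intervalIntegral.integral_of_le zero_le_one, MeasureTheory.integral_Ioc_eq_integral_Ioo,
    MeasureTheory.integral_eq_zero_of_ae (by
      filter_upwards [hzero] with w hw
      simp only [hw, mul_zero, Pi.zero_apply])] at hmain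
  rw [intervalIntegral.integral_of_le zero_le_two,
    MeasureTheory.setIntegral_eq_of_subset_of_forall_sdiff_eq_zero measurableSet_Ioc
      (Set.Ioc_subset_Ioc_left hε.le) (fun t ht => ?_)]
  · have heq : ∀ t ∈ Set.Ioc ε 2, t ^ (1 - (α : ℝ)) * h t * besselJ α (lam * t) =
        (-C * 2 ^ α / 2) * (signFlip h t / (2 * t) ^ α * (2 * t *
          primitiveOne (fun x => besselSeries 0 (c * (1 + t ^ 2 - 2 * t * x)) *
            chebyshevProfile α x) (hypCos t 0))) := by
      intro t ht
      have ht0 : 0 < t := hε.trans ht.1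
      rw [primitiveOne_chebyshevProfile_eq_crossIntegral α c ht0, ← Real.exp_log ht0, hC,
        Real.exp_log ht0, Real.rpow_sub ht0, Real.rpow_one, Real.rpow_natCast, signFlip, mul_pow]
      split_ifs <;> field_simp
    rw [MeasureTheory.setIntegral_congr_fun measurableSet_Ioc heq,
      MeasureTheory.integral_const_mul, ← hmain, mul_zero]
  · rw [hh0 t ⟨ht.1.1, not_lt.1 fun hlt => ht.2 ⟨hlt, ht.1.2⟩⟩]
    ring
end

section
/- Let α be a nonnegative integer. Define u_α : ℝ → ℝ by u_α(ξ) = Σ_{k≥0} (-1)^k α! ξ^k / (4^k k! (k+α)!) (so that u_α(x^2) = j_α(x) for x > 0). Define the coefficients a_0 = 1 and a_j = 2(α-j) a_{j-1} for 1 ≤ j ≤ α-1, and for z, w > 0 define S_α(z,w) = (α/2^{2α-2}) Σ_{j=0}^{α-1} a_j T_j(z,w), where T_j(z,w) = Σ_{q=⌈j/2⌉}^{j} Σ_{r=0}^{2q-j} C(2q-j, r) · (-1)^j (2α)! (α-q)! j! / ((2α-2q)! α! (2q-j)! (j-q)!) · 2^r w^{2r} (z^2-w^2)^{2α-j-r-1}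 / (z^{2α} w^{2α}) (for α = 0 set S_0 ≡ 0). Then there exists a nonzero real constant C(α), depending only on α, such that for all real z > w > 0: ∫_0^{ln(z/w)} u_α(z^2 + w^2 - 2zw cosh ζ) (sinh ζ)^{2α} dζ - S_α(z,w) = C(α) ( j_α(z) y_α(w) - y_α(z) j_α(w) ). -/
/-- Partial harmonic sum `H_k = Σ_{i=1}^k 1/i`. -/
noncomputable def harmonicSum (k : ℕ) : ℝ := ∑ i ∈ Finset.range k, (1 : ℝ) / (i + 1)

/-- Bessel function of the second kind of integer order `α`. -/
noncomputable def besselY (α : ℕ) (x : ℝ) : ℝ :=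
  (2 / Real.pi) * (Real.log (x / 2) + Real.eulerMascheroniConstant) * besselJ α x
    - (1 / Real.pi) * ∑ k ∈ Finset.range α,
        ((Nat.factorial (α - k - 1) : ℝ) / (Nat.factorial k : ℝ)) *
          (x / 2) ^ (2 * (k : ℤ) - (α : ℤ))
    - (1 / Real.pi) * ∑' k : ℕ,
        (-1 : ℝ) ^ k * (harmonicSum k + harmonicSum (k + α)) /
            ((Nat.factorial k : ℝ) * (Nat.factorial (k + α) : ℝ)) *
          (x / 2) ^ (2 * k + α)

/-- Normalized Bessel function of the first kind: `j_α(x) = 2^α α! J_α(x) / x^α`. -/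
noncomputable def besselj (α : ℕ) (x : ℝ) : ℝ :=
  2 ^ α * (Nat.factorial α : ℝ) * besselJ α x / x ^ α

/-- Normalized Bessel function of the second kind: `y_α(x) = 2^α α! Y_α(x) / x^α`. -/
noncomputable def bessely (α : ℕ) (x : ℝ) : ℝ :=
  2 ^ α * (Nat.factorial α : ℝ) * besselY α x / x ^ α

/-- The entire function `u_α` with `u_α(x²) = j_α(x)`:
`u_α(ξ) = Σ_{k≥0} (-1)^k α! ξ^k / (4^k k! (k+α)!)`. -/
noncomputable def uBessel (α : ℕ) (ξ : ℝ) : ℝ :=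
  ∑' k : ℕ, (-1 : ℝ) ^ k * (Nat.factorial α : ℝ) * ξ ^ k /
    ((4 : ℝ) ^ k * (Nat.factorial k : ℝ) * (Nat.factorial (k + α) : ℝ))

/-- The coefficients `a_0 = 1`, `a_j = 2(α-j) a_{j-1}`. -/
noncomputable def aCoef (α : ℕ) : ℕ → ℝ
  | 0 => 1
  | j + 1 => 2 * ((α : ℝ) - (j + 1)) * aCoef α j

/-- The inner double sum `T_j(z,w)` appearing in the Nicholson-type formula. -/
noncomputable def nicholsonT (α j : ℕ) (z w : ℝ) : ℝ :=
  ∑ q ∈ Finset.Icc ((j + 1) / 2) j, ∑ r ∈ Finset.range (2 * q - j + 1),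
    (Nat.choose (2 * q - j) r : ℝ) *
      ((-1 : ℝ) ^ j *
        ((Nat.factorial (2 * α) : ℝ) * (Nat.factorial (α - q) : ℝ) *
            (Nat.factorial j : ℝ)) /
          ((Nat.factorial (2 * α - 2 * q) : ℝ) * (Nat.factorial α : ℝ) *
            (Nat.factorial (2 * q - j) : ℝ) * (Nat.factorial (j - q) : ℝ))) *
      (2 : ℝ) ^ r * w ^ (2 * r) * (z ^ 2 - w ^ 2) ^ (2 * α - j - r - 1) /
      (z ^ (2 * α) * w ^ (2 * α))

/-- The polynomial part `S_α(z,w) = (α/2^{2α-2}) Σ_{j=0}^{α-1} a_j T_j(z,w)`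
(for `α = 0` the sum is empty and `S_0 ≡ 0`). -/
noncomputable def nicholsonS (α : ℕ) (z w : ℝ) : ℝ :=
  ((α : ℝ) / (2 : ℝ) ^ (2 * (α : ℤ) - 2)) *
    ∑ j ∈ Finset.range α, aCoef α j * nicholsonT α j z w

open Topology Filter

theorem hasDerivAt_intervalIntegral_of_continuous {F F' : ℝ → ℝ → ℝ}
    (hF : Continuous F.uncurry) (hF' : Continuous F'.uncurry)
    (hd : ∀ z t, HasDerivAt (fun z => F z t) (F' z t) z) (a b z₀ : ℝ) :
    HasDerivAt (fun z => ∫ t in a..b, F z t) (∫ t in a..b, F' z₀ t) z₀ := by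
  have hK : IsCompact (Metric.closedBall z₀ 1 ×ˢ Set.uIcc a b) :=
    (isCompact_closedBall z₀ 1).prod isCompact_uIcc
  obtain ⟨M, hM⟩ := hK.exists_bound_of_continuousOn hF'.continuousOn
  have cF : ∀ z, Continuous (F z) := fun z => hF.comp (Continuous.prodMk_right z)
  have cF' : ∀ z, Continuous (F' z) := fun z => hF'.comp (Continuous.prodMk_right z)
  refine (intervalIntegral.hasDerivAt_integral_of_dominated_loc_of_deriv_le
    (bound := fun _ => M) (Metric.closedBall_mem_nhds z₀ one_pos)
    (Eventually.of_forall fun z => (cF z).aestronglyMeasurable)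
    ((cF z₀).intervalIntegrable a b) (cF' z₀).aestronglyMeasurable
    (Eventually.of_forall fun t ht z hz => ?_) intervalIntegrable_const
    (Eventually.of_forall fun t _ z _ => hd z t)).2
  exact hM (z, t) ⟨hz, Set.uIoc_subset_uIcc ht⟩

/-- Leibniz rule with a moving upper endpoint. -/
theorem hasDerivAt_intervalIntegral_moving {F F' : ℝ → ℝ → ℝ}
    (hF : Continuous F.uncurry) (hF' : Continuous F'.uncurry)
    (hd : ∀ z t, HasDerivAt (fun z => F z t) (F' z t) z) (a : ℝ) {b : ℝ → ℝ} {b' z₀ : ℝ}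
    (hb : HasDerivAt b b' z₀) :
    HasDerivAt (fun z => ∫ t in a..b z, F z t)
      ((∫ t in a..b z₀, F' z₀ t) + F z₀ (b z₀) * b') z₀ := by
  have cF : ∀ z, Continuous (F z) := fun z => hF.comp (Continuous.prodMk_right z)
  have key := hasStrictFDerivAt_uncurry_coprod (𝕜 := ℝ) (u := (z₀, b z₀))
    (f := fun z c => ∫ t in a..c, F z t)
    (f₁ := fun z c => ContinuousLinearMap.toSpanSingleton ℝ (∫ t in a..c, F' z t))
    (f₂ := fun z c => ContinuousLinearMap.toSpanSingleton ℝ (F z c))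
    (Eventually.of_forall fun v =>
      (hasDerivAt_intervalIntegral_of_continuous hF hF' hd a v.2 v.1).hasFDerivAt)
    (Eventually.of_forall fun v =>
      (intervalIntegral.integral_hasDerivAt_right ((cF v.1).intervalIntegrable _ _)
        ((cF v.1).stronglyMeasurableAtFilter _ _) (cF v.1).continuousAt).hasFDerivAt)
    ?_ ?_
  · have h := key.hasFDerivAt.comp_hasDerivAt z₀ ((hasDerivAt_id z₀).prodMk hb)
    refine HasDerivAt.congr_deriv (f := fun z => ∫ t in a..b z, F z t) h ?_
    simp [Function.HasUncurry.uncurry, mul_comm]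
  · exact ((ContinuousLinearMap.toSpanSingletonCLE (𝕜 := ℝ) (E := ℝ)).continuous.comp
      (intervalIntegral.continuous_parametric_primitive_of_continuous hF')).continuousAt
  · exact ((ContinuousLinearMap.toSpanSingletonCLE (𝕜 := ℝ) (E := ℝ)).continuous.comp
      hF).continuousAt

/-- Uniqueness for the equation `f'' + (c / z) f' + f = 0` on `[w, ∞)`, by the energy method. -/
theorem eq_zero_of_bessel_ode {c w : ℝ} (hc : 0 ≤ c) (hw : 0 < w) {f f₁ f₂ : ℝ → ℝ}
    (h₁ : ∀ z, w ≤ z → HasDerivAt f (f₁ z) z) (h₂ : ∀ z, w ≤ z → HasDerivAt f₁ (f₂ z) z)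
    (hode : ∀ z, w < z → f₂ z + c / z * f₁ z + f z = 0) (h0 : f w = 0) (h0' : f₁ w = 0)
    {z : ℝ} (hz : w ≤ z) : f z = 0 := by
  have hE : ∀ x, w ≤ x →
      HasDerivAt (fun x => f x ^ 2 + f₁ x ^ 2) (2 * f x * f₁ x + 2 * f₁ x * f₂ x) x := by
    intro x hx
    convert! ((h₁ x hx).pow 2).add ((h₂ x hx).pow 2) using 1
    ring
  have hanti : AntitoneOn (fun x => f x ^ 2 + f₁ x ^ 2) (Set.Ici w) := by
    refine antitoneOn_of_deriv_nonpos (convex_Ici w)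
      (fun x hx => (hE x hx).continuousAt.continuousWithinAt)
      (fun x hx => ?_) (fun x hx => ?_)
    · rw [interior_Ici] at hx
      exact (hE x (le_of_lt hx)).differentiableAt.differentiableWithinAt
    · rw [interior_Ici] at hx
      rw [(hE x (le_of_lt hx)).deriv]
      have hx0 : 0 < x := hw.trans hx
      have : f₂ x = -(c / x * f₁ x) - f x := by linarith [hode x hx]
      have hp : 0 ≤ c / x * f₁ x ^ 2 := by positivity
      rw [this]
      nlinarith
  have h := hanti Set.self_mem_Ici hz hz
  simp only [h0, h0'] at h
  nlinarith [sq_nonneg (f z), sq_nonneg (f₁ z)]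

/-- The coefficients of an everywhere convergent real power series. -/
def EntireCoeff (c : ℕ → ℝ) : Prop := ∀ R : ℝ, Summable fun k => c k * R ^ k

/-- The sum of a real power series. -/
noncomputable def seriesSum (c : ℕ → ℝ) (x : ℝ) : ℝ := ∑' k, c k * x ^ k

/-- The coefficients of the derivative of a power series. -/
def derivCoeff (c : ℕ → ℝ) (k : ℕ) : ℝ := (k + 1) * c (k + 1)

theorem EntireCoeff.hasSum {c : ℕ → ℝ} (hc : EntireCoeff c) (x : ℝ) :
    HasSum (fun k => c k * x ^ k) (seriesSum c x) := (hc x).hasSum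

theorem EntireCoeff.derivCoeff {c : ℕ → ℝ} (hc : EntireCoeff c) : EntireCoeff (derivCoeff c) := by
  intro R
  have h := ((summable_nat_add_iff 1).2 (hc (2 * (|R| + 1)))).abs
  refine Summable.of_norm_bounded h fun k => ?_
  have h2 : (k : ℝ) + 1 ≤ 2 ^ (k + 1) := by
    exact_mod_cast (Nat.lt_two_pow_self (n := k + 1)).le
  have h3 : |R| ^ k ≤ (|R| + 1) ^ (k + 1) :=
    calc |R| ^ k ≤ (|R| + 1) ^ k := by gcongr; linarith
      _ ≤ (|R| + 1) ^ (k + 1) := by gcongr <;> simp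
  have h4 : |(k : ℝ) + 1| = k + 1 := abs_of_nonneg (by positivity)
  simp only [_root_.derivCoeff, Real.norm_eq_abs, abs_mul, abs_pow, mul_pow, h4]
  rw [abs_of_nonneg (by norm_num : (0 : ℝ) ≤ 2), abs_of_nonneg (by positivity : 0 ≤ |R| + 1)]
  calc ((k : ℝ) + 1) * |c (k + 1)| * |R| ^ k
      ≤ 2 ^ (k + 1) * |c (k + 1)| * (|R| + 1) ^ (k + 1) := by gcongr
    _ = _ := by ring

theorem EntireCoeff.hasDerivAt {c : ℕ → ℝ} (hc : EntireCoeff c) (x : ℝ) :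
    HasDerivAt (seriesSum c) (seriesSum (_root_.derivCoeff c) x) x := by
  have hd := hc.derivCoeff
  have key := hasDerivAt_tsum_of_isPreconnected (y₀ := x) (y := x)
    (u := fun k => |c k * (k * (|x| + 1) ^ (k - 1))|)
    (g := fun k y => c k * y ^ k) (g' := fun k y => c k * (k * y ^ (k - 1)))
    (t := Metric.ball 0 (|x| + 1)) ?_ Metric.isOpen_ball
    (convex_ball 0 _).isPreconnected (fun k y _ => (hasDerivAt_pow k y).const_mul _) ?_
    (by simp) (hc x) (by simp)
  · refine key.congr_deriv ?_
    have hs : Summable fun k : ℕ => c k * (k * x ^ (k - 1)) := by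
      rw [← summable_nat_add_iff 1]
      refine (hd x).congr fun k => ?_
      simp [_root_.derivCoeff]; ring
    rw [hs.tsum_eq_zero_add]
    simp only [seriesSum, _root_.derivCoeff, Nat.cast_zero, zero_mul, mul_zero, zero_add]
    refine tsum_congr fun k => ?_
    simp; ring
  · refine Summable.abs ?_
    rw [← summable_nat_add_iff 1]
    refine (hd (|x| + 1)).congr fun k => ?_
    simp [_root_.derivCoeff]; ring
  · intro k y hy
    rw [mem_ball_zero_iff, Real.norm_eq_abs] at hy
    rw [Real.norm_eq_abs, abs_mul, abs_mul, abs_pow, abs_mul, abs_mul, abs_pow,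
      abs_of_nonneg (by positivity : 0 ≤ |x| + 1)]
    gcongr

theorem EntireCoeff.continuous {c : ℕ → ℝ} (hc : EntireCoeff c) : Continuous (seriesSum c) :=
  continuous_iff_continuousAt.2 fun x => (hc.hasDerivAt x).continuousAt

theorem seriesSum_zero (c : ℕ → ℝ) : seriesSum c 0 = c 0 := by
  rw [seriesSum, tsum_eq_single 0 fun k hk => by simp [hk]]
  simp

theorem EntireCoeff.of_bound {c : ℕ → ℝ} {A : ℝ} (h : ∀ k, |c k| ≤ A / k.factorial) :
    EntireCoeff c := by
  intro R
  refine Summable.of_norm_bounded ((Real.summable_pow_div_factorial |R|).mul_left A) fun k => ?_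
  rw [Real.norm_eq_abs, abs_mul, abs_pow]
  calc |c k| * |R| ^ k ≤ A / k.factorial * |R| ^ k := by gcongr; exact h k
    _ = _ := by ring

theorem hasSum_of_hasSum_succ {f : ℕ → ℝ} {s : ℝ} (h0 : f 0 = 0)
    (h : HasSum (fun k => f (k + 1)) s) : HasSum f s := by
  have := (hasSum_nat_add_iff (f := f) 1).1 h
  simpa [h0] using this

theorem EntireCoeff.hasSum_euler {c : ℕ → ℝ} (hc : EntireCoeff c) (x : ℝ) :
    HasSum (fun k : ℕ => k * c k * x ^ k) (x * seriesSum (_root_.derivCoeff c) x) := by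
  refine hasSum_of_hasSum_succ (by simp) ?_
  refine ((hc.derivCoeff.hasSum x).mul_left x).congr_fun fun k => ?_
  simp only [_root_.derivCoeff]; push_cast; ring

theorem EntireCoeff.hasSum_euler_two {c : ℕ → ℝ} (hc : EntireCoeff c) (x : ℝ) :
    HasSum (fun k : ℕ => k * (k - 1) * c k * x ^ k)
      (x ^ 2 * seriesSum (_root_.derivCoeff (_root_.derivCoeff c)) x) := by
  refine hasSum_of_hasSum_succ (by simp) ?_
  rw [pow_two, mul_assoc]
  refine ((hc.derivCoeff.hasSum_euler x).mul_left x).congr_fun fun k => ?_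
  simp only [_root_.derivCoeff]; push_cast; ring

/-- The Taylor coefficients of `uBessel α`. -/
noncomputable def uCoeff (α k : ℕ) : ℝ :=
  (-1) ^ k * (α.factorial : ℝ) / (4 ^ k * (k.factorial : ℝ) * ((k + α).factorial : ℝ))

/-- The Taylor coefficients of the part of `z ^ (2 α) * bessely α z` without logarithm, as a
function of `z ^ 2`. -/
noncomputable def vCoeff (α m : ℕ) : ℝ :=
  if m < α then
    -(1 / Real.pi) * (4 ^ α * (α.factorial : ℝ)) *
      (((α - m - 1).factorial : ℝ) / (m.factorial : ℝ)) / 4 ^ m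
  else -(1 / Real.pi) * (harmonicSum (m - α) + harmonicSum m) * uCoeff α (m - α)

theorem uCoeff_zero (α : ℕ) : uCoeff α 0 = 1 := by
  have : (α.factorial : ℝ) ≠ 0 := by positivity
  simp [uCoeff, this]

theorem uCoeff_succ (α k : ℕ) :
    4 * ((k : ℝ) + 1) * (k + 1 + α) * uCoeff α (k + 1) = -uCoeff α k := by
  have h : k + 1 + α = (k + α) + 1 := by ring
  simp only [uCoeff, h, Nat.factorial_succ]
  push_cast
  have h1 : (k : ℝ) + 1 ≠ 0 := by positivity
  have h2 : (k : ℝ) + α + 1 ≠ 0 := by positivity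
  field_simp
  ring

theorem harmonicSum_succ (k : ℕ) : harmonicSum (k + 1) = harmonicSum k + 1 / (k + 1) := by
  simp [harmonicSum, Finset.sum_range_succ]

theorem harmonicSum_nonneg (k : ℕ) : 0 ≤ harmonicSum k :=
  Finset.sum_nonneg fun i _ => by positivity

theorem harmonicSum_le (k : ℕ) : harmonicSum k ≤ k := by
  calc harmonicSum k ≤ ∑ i ∈ Finset.range k, (1 : ℝ) := by
        refine Finset.sum_le_sum fun i _ => ?_
        rw [div_le_one (by positivity)]
        linarith [(Nat.cast_nonneg i : (0 : ℝ) ≤ i)]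
    _ = k := by simp

theorem abs_uCoeff (α k : ℕ) :
    |uCoeff α k| = (α.factorial : ℝ) / (4 ^ k * (k.factorial : ℝ) * ((k + α).factorial : ℝ)) := by
  rw [uCoeff, abs_div, abs_mul, abs_pow, abs_neg, abs_one, one_pow, one_mul, Nat.abs_cast,
    abs_of_nonneg (by positivity)]

theorem entireCoeff_uCoeff (α : ℕ) : EntireCoeff (uCoeff α) := by
  refine EntireCoeff.of_bound (A := α.factorial) fun k => ?_
  rw [abs_uCoeff]
  gcongr
  calc (k.factorial : ℝ) = 1 * k.factorial * 1 := by ring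
    _ ≤ 4 ^ k * k.factorial * (k + α).factorial := by
      gcongr
      · exact one_le_pow₀ (by norm_num)
      · exact_mod_cast Nat.one_le_iff_ne_zero.2 (Nat.factorial_ne_zero _)

theorem entireCoeff_of_nat_add {c : ℕ → ℝ} (n : ℕ) (h : EntireCoeff fun k => c (k + n)) :
    EntireCoeff c := by
  intro R
  rw [← summable_nat_add_iff n]
  refine ((h R).mul_right (R ^ n)).congr fun k => ?_
  ring

theorem entireCoeff_vCoeff (α : ℕ) : EntireCoeff (vCoeff α) := by
  refine entireCoeff_of_nat_add α (EntireCoeff.of_bound (A := 1 / Real.pi * 2 * α.factorial)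
    fun k => ?_)
  have hpi := Real.pi_pos
  have hk : ((k : ℝ) + α) ≤ (k + α).factorial := by exact_mod_cast Nat.self_le_factorial (k + α)
  have hH : harmonicSum k + harmonicSum (k + α) ≤ 2 * (k + α).factorial := by
    have h1 := harmonicSum_le k
    have h2 := harmonicSum_le (k + α)
    push_cast at h2
    linarith [(Nat.cast_nonneg α : (0 : ℝ) ≤ α)]
  have h0 : 0 ≤ harmonicSum k + harmonicSum (k + α) :=
    add_nonneg (harmonicSum_nonneg _) (harmonicSum_nonneg _)
  have h4 : (1 : ℝ) ≤ 4 ^ k := one_le_pow₀ (by norm_num)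
  simp only [vCoeff, if_neg (by omega : ¬ k + α < α), Nat.add_sub_cancel, abs_mul, abs_neg,
    abs_uCoeff, abs_of_nonneg h0, abs_of_nonneg (by positivity : 0 ≤ 1 / Real.pi)]
  calc 1 / Real.pi * (harmonicSum k + harmonicSum (k + α)) *
        ((α.factorial : ℝ) / (4 ^ k * (k.factorial : ℝ) * ((k + α).factorial : ℝ)))
      ≤ 1 / Real.pi * (2 * (k + α).factorial) *
        ((α.factorial : ℝ) / (1 * (k.factorial : ℝ) * ((k + α).factorial : ℝ))) := by gcongr
    _ = _ := by field_simp

theorem vCoeff_rec_add (α k : ℕ) :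
    4 * ((k : ℝ) + α) * k * vCoeff α (k + α) +
        (if k + α = 0 then 0 else vCoeff α (k + α - 1)) =
      -(2 / Real.pi) * (4 * k + 2 * α) * uCoeff α k := by
  have hpi := Real.pi_ne_zero
  rcases k with _ | k
  · rcases α with _ | a
    · simp
    · have ha : (a.factorial : ℝ) ≠ 0 := by positivity
      simp only [vCoeff, uCoeff_zero, Nat.factorial_succ]
      simp
      field_simp
      ring
  · have e : k + 1 + α - 1 = k + α := by omega
    have e2 : k + 1 + α = (k + α) + 1 := by omega
    rw [if_neg (by omega), e]
    simp only [vCoeff, if_neg (by omega : ¬ k + α < α), if_neg (by omega : ¬ k + 1 + α < α),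
      Nat.add_sub_cancel]
    rw [e2, harmonicSum_succ, harmonicSum_succ, ← neg_eq_iff_eq_neg.2 (uCoeff_succ α k)]
    have h1 : (k : ℝ) + 1 ≠ 0 := by positivity
    have h2 : (k : ℝ) + α + 1 ≠ 0 := by positivity
    push_cast
    field_simp
    ring

theorem vCoeff_rec_lt {α m : ℕ} (hm : m < α) :
    4 * (m : ℝ) * (m - α) * vCoeff α m + (if m = 0 then 0 else vCoeff α (m - 1)) = 0 := by
  rcases m with _ | m
  · simp
  · obtain ⟨n, rfl⟩ : ∃ n, α = m + 1 + 1 + n := ⟨α - (m + 1 + 1), by omega⟩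
    have e1 : m + 1 + 1 + n - (m + 1) - 1 = n := by omega
    have e2 : m + 1 + 1 + n - m - 1 = n + 1 := by omega
    rw [if_neg (by omega), Nat.add_sub_cancel]
    simp only [vCoeff, if_pos hm, if_pos (by omega : m < m + 1 + 1 + n), e1, e2]
    rw [Nat.factorial_succ n, Nat.factorial_succ m]
    push_cast
    have h1 : (m : ℝ) + 1 ≠ 0 := by positivity
    have hpi := Real.pi_ne_zero
    field_simp
    ring

theorem uSeries_ode (α : ℕ) (x : ℝ) :
    4 * (x * seriesSum (derivCoeff (derivCoeff (uCoeff α))) x +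
        (α + 1) * seriesSum (derivCoeff (uCoeff α)) x) + seriesSum (uCoeff α) x = 0 := by
  have hu := entireCoeff_uCoeff α
  have h := (((hu.derivCoeff.hasSum_euler x).add
    ((hu.derivCoeff.hasSum x).mul_left ((α : ℝ) + 1))).mul_left 4).add (hu.hasSum x)
  refine h.unique (hasSum_zero.congr_fun fun k => ?_)
  simp only [derivCoeff]
  linear_combination (x ^ k) * uCoeff_succ α k

theorem vSeries_ode (α : ℕ) (x : ℝ) :
    x * (4 * (x * seriesSum (derivCoeff (derivCoeff (vCoeff α))) x +
        (1 - α) * seriesSum (derivCoeff (vCoeff α)) x) + seriesSum (vCoeff α) x) =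
      -(2 / Real.pi) * x ^ α *
        (4 * x * seriesSum (derivCoeff (uCoeff α)) x + 2 * α * seriesSum (uCoeff α) x) := by
  have hu := entireCoeff_uCoeff α
  have hv := entireCoeff_vCoeff α
  set L : ℕ → ℝ := fun m => 4 * (m : ℝ) * (m - α) * vCoeff α m * x ^ m +
    (if m = 0 then 0 else vCoeff α (m - 1)) * x ^ m with hL
  have hshift : HasSum (fun m => (if m = 0 then 0 else vCoeff α (m - 1)) * x ^ m)
      (x * seriesSum (vCoeff α) x) := by
    refine hasSum_of_hasSum_succ (by simp) (((hv.hasSum x).mul_left x).congr_fun fun k => ?_)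
    simp; ring
  have hlhs : HasSum L (4 * (x ^ 2 * seriesSum (derivCoeff (derivCoeff (vCoeff α))) x +
      (1 - α) * (x * seriesSum (derivCoeff (vCoeff α)) x)) + x * seriesSum (vCoeff α) x) := by
    refine ((((hv.hasSum_euler_two x).add
      ((hv.hasSum_euler x).mul_left (1 - (α : ℝ)))).mul_left 4).add hshift).congr_fun
        fun k => ?_
    simp only [hL]; ring
  have hzero : ∑ m ∈ Finset.range α, L m = 0 := by
    refine Finset.sum_eq_zero fun m hm => ?_
    simp only [hL]
    linear_combination (x ^ m) * vCoeff_rec_lt (Finset.mem_range.1 hm)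
  have htail := (hasSum_nat_add_iff' (f := L) α).2 hlhs
  rw [hzero, sub_zero] at htail
  have hrhs := ((((hu.hasSum_euler x).mul_left 4).add
    ((hu.hasSum x).mul_left (2 * (α : ℝ)))).mul_left (-(2 / Real.pi) * x ^ α))
  have := htail.unique (hrhs.congr_fun fun k => ?_)
  · linear_combination this
  · simp only [hL]
    have := vCoeff_rec_add α k
    push_cast
    linear_combination (x ^ (k + α)) * this

theorem uBessel_eq (α : ℕ) : uBessel α = seriesSum (uCoeff α) := by
  funext x
  refine tsum_congr fun k => ?_
  rw [uCoeff]; ring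

theorem besselj_eq (α : ℕ) {z : ℝ} (hz : 0 < z) :
    besselj α z = seriesSum (uCoeff α) (z ^ 2) := by
  rw [besselj, besselJ, seriesSum, mul_div_right_comm, ← tsum_mul_left]
  refine tsum_congr fun k => ?_
  rw [uCoeff, div_pow, pow_add, pow_add, pow_mul 2, ← pow_mul z]
  norm_num
  field_simp

theorem bessely_eq (α : ℕ) {z : ℝ} (hz : 0 < z) :
    bessely α z = 2 / Real.pi * (Real.log (z / 2) + Real.eulerMascheroniConstant) *
        seriesSum (uCoeff α) (z ^ 2) + seriesSum (vCoeff α) (z ^ 2) / z ^ (2 * α) := by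
  have hv := (entireCoeff_vCoeff α) (z ^ 2)
  have hsplit : seriesSum (vCoeff α) (z ^ 2) =
      -(1 / Real.pi) * (2 ^ α * α.factorial) * z ^ α * (∑ k ∈ Finset.range α,
        (((α - k - 1).factorial : ℝ) / (k.factorial : ℝ)) * (z / 2) ^ (2 * (k : ℤ) - (α : ℤ)))
      + -(1 / Real.pi) * (2 ^ α * α.factorial) * z ^ α * ∑' k : ℕ,
        (-1 : ℝ) ^ k * (harmonicSum k + harmonicSum (k + α)) /
            ((k.factorial : ℝ) * ((k + α).factorial : ℝ)) * (z / 2) ^ (2 * k + α) := by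
    rw [seriesSum, ← hv.sum_add_tsum_nat_add α, Finset.mul_sum, ← tsum_mul_left]
    congr 1
    · refine Finset.sum_congr rfl fun k hk => ?_
      rw [vCoeff, if_pos (Finset.mem_range.1 hk), zpow_sub₀ (by positivity), zpow_mul]
      norm_cast
      rw [div_pow, div_pow, div_pow, ← pow_mul, ← pow_mul]
      have h4 : (4 : ℝ) ^ α = 2 ^ α * 2 ^ α := by rw [← mul_pow]; norm_num
      have h4' : (2 : ℝ) ^ (2 * k) = 4 ^ k := by rw [pow_mul]; norm_num
      push_cast
      rw [h4, h4']
      field_simp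
    · refine tsum_congr fun k => ?_
      rw [vCoeff, if_neg (by omega), Nat.add_sub_cancel, uCoeff, div_pow]
      have h4' : (2 : ℝ) ^ (2 * k + α) = 4 ^ k * 2 ^ α := by rw [pow_add, pow_mul]; norm_num
      rw [h4']
      field_simp
      ring
  rw [hsplit, ← besselj_eq α hz, bessely, besselY, besselj]
  field_simp
  ring

/-- `f`, with derivative `f₁`, is twice differentiable on `[w, ∞)` and solves
`f'' + ((2 α + 1) / z) f' + f = g` on `(w, ∞)`. -/
def SolvesBessel (α : ℕ) (w : ℝ) (f f₁ g : ℝ → ℝ) : Prop :=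
  ∀ z, w ≤ z → HasDerivAt f (f₁ z) z ∧ ∃ d, HasDerivAt f₁ d z ∧
    (w < z → d + (2 * α + 1) / z * f₁ z + f z = g z)

namespace SolvesBessel

variable {α : ℕ} {w : ℝ} {f f₁ g h h₁ k : ℝ → ℝ}

theorem sub (hf : SolvesBessel α w f f₁ g) (hh : SolvesBessel α w h h₁ k) :
    SolvesBessel α w (fun z => f z - h z) (fun z => f₁ z - h₁ z) (fun z => g z - k z) := by
  intro z hz
  obtain ⟨hf₁, d, hd, hf⟩ := hf z hz
  obtain ⟨hh₁, e, he, hh⟩ := hh z hz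
  refine ⟨hf₁.sub hh₁, d - e, hd.sub he, fun hz' => ?_⟩
  linear_combination hf hz' - hh hz'

theorem const_mul (c : ℝ) (hf : SolvesBessel α w f f₁ g) :
    SolvesBessel α w (fun z => c * f z) (fun z => c * f₁ z) (fun z => c * g z) := by
  intro z hz
  obtain ⟨hf₁, d, hd, hf⟩ := hf z hz
  refine ⟨hf₁.const_mul c, c * d, hd.const_mul c, fun hz' => ?_⟩
  linear_combination c * hf hz'

theorem eq_zero (hf : SolvesBessel α w f f₁ g) (hg : ∀ z, w < z → g z = 0) (hw : 0 < w)
    (h0 : f w = 0) (h1 : f₁ w = 0) {z : ℝ} (hz : w ≤ z) : f z = 0 := by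
  refine eq_zero_of_bessel_ode (c := 2 * α + 1) (f₂ := deriv f₁) (by positivity) hw
    (fun z hz => (hf z hz).1) (fun z hz => ?_) (fun z hz => ?_) h0 h1 hz
  all_goals obtain ⟨-, d, hd, h⟩ := hf z (by order)
  · exact hd.differentiableAt.hasDerivAt
  · rw [hd.deriv, h hz, hg z hz]

end SolvesBessel

theorem HasDerivAt.comp_sq {p : ℝ → ℝ} {p' z : ℝ} (h : HasDerivAt p p' (z ^ 2)) :
    HasDerivAt (fun z => p (z ^ 2)) (p' * (2 * z)) z := by
  have := HasDerivAt.comp (h := fun z : ℝ => z ^ 2) z h (hasDerivAt_pow 2 z)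
  simpa [Function.comp_def] using this

theorem solvesBessel_comp_sq_div {α : ℕ} {w : ℝ} (hw : 0 < w) {p p₁ p₂ q : ℝ → ℝ}
    (h₁ : ∀ x, HasDerivAt p (p₁ x) x) (h₂ : ∀ x, HasDerivAt p₁ (p₂ x) x)
    (hq : ∀ x, w ^ 2 < x → 4 * (x * p₂ x + (1 - α) * p₁ x) + p x = q x) :
    SolvesBessel α w (fun z => p (z ^ 2) / z ^ (2 * α))
      (fun z => p₁ (z ^ 2) * (2 * z) / z ^ (2 * α) - 2 * α * p (z ^ 2) / z ^ (2 * α + 1))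
      (fun z => q (z ^ 2) / z ^ (2 * α)) := by
  have hpow : ∀ (n : ℕ) {f : ℝ → ℝ} {f' z : ℝ}, 0 < z → HasDerivAt f f' z →
      HasDerivAt (fun z => f z / z ^ n) (f' / z ^ n - n * f z / z ^ (n + 1)) z := by
    intro n f f' z hz hf
    refine (hf.div (hasDerivAt_pow n z) (pow_ne_zero n hz.ne')).congr_deriv ?_
    rcases n with _ | n
    · simp
    · simp only [Nat.add_sub_cancel]
      field_simp
      ring
  intro z hz
  have hz0 : 0 < z := hw.trans_le hz
  refine ⟨?_, _, (hpow (2 * α) hz0 ((h₂ _).comp_sq.mul ((hasDerivAt_id z).const_mul 2))).sub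
    (hpow (2 * α + 1) hz0 ((h₁ _).comp_sq.const_mul (2 * (α : ℝ)))), fun hz' => ?_⟩
  · refine (hpow (2 * α) hz0 (h₁ _).comp_sq).congr_deriv ?_
    push_cast
    ring
  · have h := hq (z ^ 2) (by gcongr)
    simp only [Pi.mul_apply, id]
    rw [← h]
    push_cast
    field_simp
    ring

/-- The derivative of `besselj α`. -/
noncomputable def besseljDeriv (α : ℕ) (z : ℝ) : ℝ :=
  seriesSum (derivCoeff (uCoeff α)) (z ^ 2) * (2 * z)

/-- The derivative of `bessely α`. -/
noncomputable def besselyDeriv (α : ℕ) (z : ℝ) : ℝ :=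
  2 / Real.pi * (seriesSum (uCoeff α) (z ^ 2) / z +
      (Real.log (z / 2) + Real.eulerMascheroniConstant) * besseljDeriv α z) +
    (seriesSum (derivCoeff (vCoeff α)) (z ^ 2) * (2 * z) / z ^ (2 * α) -
      2 * α * seriesSum (vCoeff α) (z ^ 2) / z ^ (2 * α + 1))

theorem solvesBessel_besselj (α : ℕ) {w : ℝ} (hw : 0 < w) :
    SolvesBessel α w (besselj α) (besseljDeriv α) 0 := by
  have hu := entireCoeff_uCoeff α
  intro z hz
  have hz0 : 0 < z := hw.trans_le hz
  refine ⟨(hu.hasDerivAt _).comp_sq.congr_of_eventuallyEq ?_,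
    _, (hu.derivCoeff.hasDerivAt _).comp_sq.mul ((hasDerivAt_id z).const_mul 2), fun _ => ?_⟩
  · filter_upwards [lt_mem_nhds hz0] with x hx using besselj_eq α hx
  · rw [besselj_eq α hz0, besseljDeriv]
    simp only [Pi.zero_apply]
    rw [← uSeries_ode α (z ^ 2)]
    field_simp
    ring

theorem solvesBessel_bessely (α : ℕ) {w : ℝ} (hw : 0 < w) :
    SolvesBessel α w (bessely α) (besselyDeriv α) 0 := by
  have hu := entireCoeff_uCoeff α
  have hv := entireCoeff_vCoeff α
  have hV := solvesBessel_comp_sq_div (α := α) hw hv.hasDerivAt hv.derivCoeff.hasDerivAt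
    (q := fun x => -(2 / Real.pi) * x ^ α *
        (4 * x * seriesSum (derivCoeff (uCoeff α)) x + 2 * α * seriesSum (uCoeff α) x) / x)
    (fun x hx => by
      have hx0 : 0 < x := (sq_nonneg w).trans_lt hx
      rw [← vSeries_ode]
      field_simp)
  have hlog : ∀ z : ℝ, 0 < z →
      HasDerivAt (fun z => Real.log (z / 2) + Real.eulerMascheroniConstant) (1 / z) z := by
    intro z hz
    have := (((hasDerivAt_id z).div_const 2).log (by simpa using hz.ne')).add_const
      Real.eulerMascheroniConstant
    refine this.congr_deriv ?_
    simp only [id]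
    field_simp
  have hU : ∀ z, w ≤ z →
      HasDerivAt (fun z => seriesSum (uCoeff α) (z ^ 2)) (besseljDeriv α z) z :=
    fun z _ => (hu.hasDerivAt _).comp_sq
  intro z hz
  have hz0 : 0 < z := hw.trans_le hz
  obtain ⟨-, j₂, hj₂, hj⟩ := solvesBessel_besselj α hw z hz
  obtain ⟨hv₁, v₂, hv₂, hV⟩ := hV z hz
  refine ⟨?_, _, ((((hU z hz).div (hasDerivAt_id z) hz0.ne').add
    ((hlog z hz0).mul hj₂)).const_mul (2 / Real.pi)).add hv₂, fun hz' => ?_⟩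
  · have h : HasDerivAt (fun z => 2 / Real.pi *
          ((Real.log (z / 2) + Real.eulerMascheroniConstant) * seriesSum (uCoeff α) (z ^ 2)) +
        seriesSum (vCoeff α) (z ^ 2) / z ^ (2 * α)) (besselyDeriv α z) z := by
      refine ((((hlog z hz0).mul (hU z hz)).const_mul (2 / Real.pi)).add
        hv₁).congr_deriv ?_
      simp only [besselyDeriv]
      ring
    refine h.congr_of_eventuallyEq ?_
    filter_upwards [lt_mem_nhds hz0] with x hx
    rw [bessely_eq α hx]
    ring
  · have e1 := hj hz'
    have e2 := hV hz'
    rw [besselj_eq α hz0] at e1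
    rw [bessely_eq α hz0, besselyDeriv]
    simp only [id, Pi.zero_apply] at e1 e2 ⊢
    have e3 : (z ^ 2) ^ α / z ^ (2 * α) = 1 := by
      rw [← pow_mul, div_self (by positivity)]
    have e4 : -(2 / Real.pi) * (z ^ 2) ^ α *
        (4 * z ^ 2 * seriesSum (derivCoeff (uCoeff α)) (z ^ 2) +
          2 * α * seriesSum (uCoeff α) (z ^ 2)) / z ^ 2 / z ^ (2 * α) = -(2 / Real.pi) *
        (2 * besseljDeriv α z / z + 2 * α * seriesSum (uCoeff α) (z ^ 2) / z ^ 2) := by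
      rw [besseljDeriv]
      calc _ = -(2 / Real.pi) * ((z ^ 2) ^ α / z ^ (2 * α)) *
        (4 * z ^ 2 * seriesSum (derivCoeff (uCoeff α)) (z ^ 2) +
          2 * α * seriesSum (uCoeff α) (z ^ 2)) / z ^ 2 := by ring
        _ = _ := by rw [e3]; field_simp; ring
    rw [e4] at e2
    linear_combination e2 + (2 / Real.pi) *
      (Real.log (z / 2) + Real.eulerMascheroniConstant) * e1 +
      (2 / Real.pi) * (besseljDeriv α z / z) *
      (mul_inv_cancel₀ hz0.ne')

/-- The weighted Wronskian of `besselj α` and `bessely α` as an entire function of `x = z ^ 2`. -/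
noncomputable def besselWronskian (α : ℕ) (x : ℝ) : ℝ :=
  2 / Real.pi * seriesSum (uCoeff α) x ^ 2 * x ^ α
    - 2 * α * seriesSum (uCoeff α) x * seriesSum (vCoeff α) x
    + 2 * x * (seriesSum (uCoeff α) x * seriesSum (derivCoeff (vCoeff α)) x -
      seriesSum (derivCoeff (uCoeff α)) x * seriesSum (vCoeff α) x)

theorem besselWronskian_zero_ne (α : ℕ) : besselWronskian α 0 ≠ 0 := by
  have hpi := Real.pi_ne_zero
  simp only [besselWronskian, seriesSum_zero, uCoeff_zero]
  rcases α with _ | a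
  · simp [hpi]
  · have h : vCoeff (a + 1) 0 ≠ 0 := by
      simp [vCoeff, Nat.factorial_ne_zero, hpi]
    simp [h]
    positivity

theorem besselWronskian_eq (α : ℕ) {x : ℝ} (hx : 0 ≤ x) :
    besselWronskian α x = besselWronskian α 0 := by
  have hu := entireCoeff_uCoeff α
  have hv := entireCoeff_vCoeff α
  have hder : ∀ x, HasDerivAt (besselWronskian α) _ x := fun x =>
    (((((hu.hasDerivAt x).pow 2).const_mul (2 / Real.pi)).mul (hasDerivAt_pow α x)).sub
      (((hu.hasDerivAt x).const_mul (2 * (α : ℝ))).mul (hv.hasDerivAt x))).add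
    (((hasDerivAt_id x).const_mul 2).mul (((hu.hasDerivAt x).mul (hv.derivCoeff.hasDerivAt x)).sub
      ((hu.derivCoeff.hasDerivAt x).mul (hv.hasDerivAt x))))
  have hder0 : ∀ x, 0 < x → HasDerivAt (besselWronskian α) 0 x := by
    intro x hx
    refine (hder x).congr_deriv ?_
    have hp : (α : ℝ) * x ^ (α - 1) = α * x ^ α / x := by
      rcases α with _ | a
      · simp
      · simp only [Nat.add_sub_cancel]; field_simp; ring
    rw [hp]
    simp only [id, Pi.pow_apply]
    have eu := uSeries_ode α x
    have ev := vSeries_ode α x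
    refine mul_left_cancel₀ hx.ne' ?_
    generalize seriesSum (uCoeff α) x = u at *
    generalize seriesSum (derivCoeff (uCoeff α)) x = u1 at *
    generalize seriesSum (derivCoeff (derivCoeff (uCoeff α))) x = u2 at *
    generalize seriesSum (vCoeff α) x = v at *
    generalize seriesSum (derivCoeff (vCoeff α)) x = v1 at *
    generalize seriesSum (derivCoeff (derivCoeff (vCoeff α))) x = v2 at *
    generalize x ^ α = X at *
    have hxx : x * (α * X / x) = α * X := by field_simp
    push_cast
    linear_combination (-(x * v) / 2) * eu + (u / 2) * ev + (2 / Real.pi * u ^ 2) * hxx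
  rcases hx.eq_or_lt with rfl | hx
  · rfl
  obtain ⟨c, hc, h⟩ := exists_hasDerivAt_eq_slope (besselWronskian α) (fun _ => 0) hx
    (fun y _ => (hder y).continuousAt.continuousWithinAt) (fun y hy => hder0 y hy.1)
  rw [eq_comm, div_eq_zero_iff] at h
  rcases h with h | h <;> linarith

theorem besselj_bessely_wronskian (α : ℕ) {w : ℝ} (hw : 0 < w) :
    bessely α w * besseljDeriv α w - besselj α w * besselyDeriv α w =
      -besselWronskian α 0 / w ^ (2 * α + 1) := by
  rw [← besselWronskian_eq α (sq_nonneg w), besselj_eq α hw, bessely_eq α hw, besselyDeriv,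
    besselWronskian, besseljDeriv, ← pow_mul]
  field_simp
  ring

theorem cosh_log_div {z w : ℝ} (hz : 0 < z) (hw : 0 < w) :
    Real.cosh (Real.log (z / w)) = (z ^ 2 + w ^ 2) / (2 * z * w) := by
  rw [Real.cosh_log (by positivity)]
  field_simp

theorem sinh_log_div {z w : ℝ} (hz : 0 < z) (hw : 0 < w) :
    Real.sinh (Real.log (z / w)) = (z ^ 2 - w ^ 2) / (2 * z * w) := by
  rw [Real.sinh_log (by positivity)]
  field_simp

theorem hasDerivAt_log_div {z w : ℝ} (hz : 0 < z) (hw : 0 < w) :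
    HasDerivAt (fun z => Real.log (z / w)) (1 / z) z := by
  refine (((hasDerivAt_id z).div_const w).log (by simp [hz.ne', hw.ne'])).congr_deriv ?_
  simp only [id]
  field_simp

/-- The squared third side `z² + w² - 2 z w cosh ζ`. -/
noncomputable def coshDistSq (w z ζ : ℝ) : ℝ := z ^ 2 + w ^ 2 - 2 * z * w * Real.cosh ζ

theorem coshDistSq_log {z w : ℝ} (hz : 0 < z) (hw : 0 < w) :
    coshDistSq w z (Real.log (z / w)) = 0 := by
  rw [coshDistSq, cosh_log_div hz hw]
  field_simp
  ring

theorem hasDerivAt_coshDistSq (w z ζ : ℝ) :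
    HasDerivAt (fun z => coshDistSq w z ζ) (2 * z - 2 * w * Real.cosh ζ) z := by
  have := (((hasDerivAt_pow 2 z).add_const (w ^ 2)).sub
    ((((hasDerivAt_id z).const_mul 2).mul_const w).mul_const (Real.cosh ζ)))
  refine this.congr_deriv ?_
  push_cast
  ring

theorem continuous_coshDistSq (w : ℝ) :
    Continuous fun p : ℝ × ℝ => coshDistSq w p.1 p.2 := by
  unfold coshDistSq
  fun_prop

/-- The Nicholson-type integral. -/
noncomputable def nicholsonIntegral (α : ℕ) (w z : ℝ) : ℝ :=
  ∫ ζ in (0 : ℝ)..Real.log (z / w),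
    seriesSum (uCoeff α) (coshDistSq w z ζ) * Real.sinh ζ ^ (2 * α)

/-- The derivative of `nicholsonIntegral α w`. -/
noncomputable def nicholsonIntegralDeriv (α : ℕ) (w z : ℝ) : ℝ :=
  (∫ ζ in (0 : ℝ)..Real.log (z / w),
    seriesSum (derivCoeff (uCoeff α)) (coshDistSq w z ζ) * (2 * z - 2 * w * Real.cosh ζ) *
      Real.sinh ζ ^ (2 * α)) + ((z ^ 2 - w ^ 2) / (2 * z * w)) ^ (2 * α) / z

theorem solvesBessel_nicholsonIntegral (α : ℕ) {w : ℝ} (hw : 0 < w) :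
    SolvesBessel α w (nicholsonIntegral α w) (nicholsonIntegralDeriv α w)
      (fun z => 2 * α * ((z ^ 2 - w ^ 2) / (2 * z * w)) ^ (2 * α - 1) / (z * w)) := by
  have hu := entireCoeff_uCoeff α
  have hu₁ := hu.derivCoeff
  have hu₂ := hu₁.derivCoeff
  have cξ := continuous_coshDistSq w
  set K : ℝ → ℝ → ℝ := fun z ζ =>
    seriesSum (uCoeff α) (coshDistSq w z ζ) * Real.sinh ζ ^ (2 * α) with hK
  set K₁ : ℝ → ℝ → ℝ := fun z ζ => seriesSum (derivCoeff (uCoeff α)) (coshDistSq w z ζ) *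
    (2 * z - 2 * w * Real.cosh ζ) * Real.sinh ζ ^ (2 * α) with hK₁
  set K₂ : ℝ → ℝ → ℝ := fun z ζ =>
    (seriesSum (derivCoeff (derivCoeff (uCoeff α))) (coshDistSq w z ζ) *
      (2 * z - 2 * w * Real.cosh ζ) * (2 * z - 2 * w * Real.cosh ζ) +
    seriesSum (derivCoeff (uCoeff α)) (coshDistSq w z ζ) * 2) * Real.sinh ζ ^ (2 * α) with hK₂
  have cu := hu.continuous.comp cξ
  have cu₁ := hu₁.continuous.comp cξ
  have cu₂ := hu₂.continuous.comp cξ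
  have clin : Continuous fun p : ℝ × ℝ => 2 * p.1 - 2 * w * Real.cosh p.2 := by fun_prop
  have cs : Continuous fun p : ℝ × ℝ => Real.sinh p.2 ^ (2 * α) := by fun_prop
  have cK : Continuous K.uncurry := cu.mul cs
  have cK₁ : Continuous K₁.uncurry := (cu₁.mul clin).mul cs
  have cK₂ : Continuous K₂.uncurry :=
    (((cu₂.mul clin).mul clin).add (cu₁.mul continuous_const)).mul cs
  have hlin : ∀ z ζ, HasDerivAt (fun z => 2 * z - 2 * w * Real.cosh ζ) 2 z := fun z ζ => by
    simpa using ((hasDerivAt_id z).const_mul 2).sub_const (2 * w * Real.cosh ζ)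
  have hcomp : ∀ {c : ℕ → ℝ} (_ : EntireCoeff c) (z ζ : ℝ),
      HasDerivAt (fun z => seriesSum c (coshDistSq w z ζ))
        (seriesSum (derivCoeff c) (coshDistSq w z ζ) * (2 * z - 2 * w * Real.cosh ζ)) z :=
    fun hc z ζ => (hc.hasDerivAt _).comp z (hasDerivAt_coshDistSq w z ζ)
  have dK : ∀ z ζ, HasDerivAt (fun z => K z ζ) (K₁ z ζ) z := fun z ζ =>
    (hcomp hu z ζ).mul_const _
  have dK₁ : ∀ z ζ, HasDerivAt (fun z => K₁ z ζ) (K₂ z ζ) z := fun z ζ =>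
    ((hcomp hu₁ z ζ).mul (hlin z ζ)).mul_const _
  intro z hz
  have hz0 : 0 < z := hw.trans_le hz
  have hL := hasDerivAt_log_div hz0 hw
  have hs : HasDerivAt (fun z => (z ^ 2 - w ^ 2) / (2 * z * w))
      ((z ^ 2 + w ^ 2) / (2 * z ^ 2 * w)) z := by
    refine (((hasDerivAt_pow 2 z).sub_const (w ^ 2)).div
      (((hasDerivAt_id z).const_mul 2).mul_const w)
      (by simp only [id]; positivity)).congr_deriv ?_
    simp only [id]
    push_cast
    field_simp
    ring
  have hI₁ := hasDerivAt_intervalIntegral_moving cK₁ cK₂ dK₁ 0 hL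
  refine ⟨(hasDerivAt_intervalIntegral_moving cK cK₁ dK 0 hL).congr_deriv ?_, _,
    hI₁.add ((hs.pow (2 * α)).div (hasDerivAt_id z) hz0.ne'), fun _ => ?_⟩
  · simp only [nicholsonIntegralDeriv, hK, coshDistSq_log hz0 hw, seriesSum_zero, uCoeff_zero,
      sinh_log_div hz0 hw]
    ring
  set M : ℝ → ℝ := fun ζ => -2 * w / z * (Real.sinh ζ ^ (2 * α + 1) *
    seriesSum (derivCoeff (uCoeff α)) (coshDistSq w z ζ)) with hM
  have dM : ∀ ζ, HasDerivAt M (K₂ z ζ + (2 * α + 1) / z * K₁ z ζ + K z ζ) ζ := by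
    intro ζ
    have hξ : HasDerivAt (fun ζ => coshDistSq w z ζ) (-(2 * z * w * Real.sinh ζ)) ζ :=
      ((Real.hasDerivAt_cosh ζ).const_mul (2 * z * w)).const_sub (z ^ 2 + w ^ 2)
    refine ((((Real.hasDerivAt_sinh ζ).pow (2 * α + 1)).mul
      ((hu₁.hasDerivAt _).comp ζ hξ)).const_mul (-2 * w / z)).congr_deriv ?_
    have hode := uSeries_ode α (coshDistSq w z ζ)
    have hcs : Real.cosh ζ ^ 2 = Real.sinh ζ ^ 2 + 1 := Real.cosh_sq ζ
    have hdist : coshDistSq w z ζ = z ^ 2 + w ^ 2 - 2 * z * w * Real.cosh ζ := rfl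
    simp only [hK, hK₁, hK₂, Pi.pow_apply, Function.comp_apply, Nat.add_sub_cancel]
    generalize seriesSum (uCoeff α) (coshDistSq w z ζ) = u at *
    generalize seriesSum (derivCoeff (uCoeff α)) (coshDistSq w z ζ) = u₁ at *
    generalize seriesSum (derivCoeff (derivCoeff (uCoeff α))) (coshDistSq w z ζ) = u₂ at *
    rw [hdist] at hode
    push_cast
    field_simp
    ring_nf at hode hcs ⊢
    linear_combination (-z * Real.sinh ζ ^ (2 * α)) * hode -
      4 * z * w ^ 2 * Real.sinh ζ ^ (2 * α) * u₂ * hcs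
  have ccK : ∀ {F : ℝ → ℝ → ℝ}, Continuous F.uncurry → Continuous (F z) :=
    fun hF => hF.comp (Continuous.prodMk_right z)
  have iK := (ccK cK).intervalIntegrable (μ := MeasureTheory.volume) 0 (Real.log (z / w))
  have iK₁ := (ccK cK₁).intervalIntegrable (μ := MeasureTheory.volume) 0 (Real.log (z / w))
  have iK₂ := (ccK cK₂).intervalIntegrable (μ := MeasureTheory.volume) 0 (Real.log (z / w))
  have hint := intervalIntegral.integral_eq_sub_of_hasDerivAt (fun ζ _ => dM ζ)
    ((iK₂.add (iK₁.const_mul ((2 * α + 1) / z))).add iK)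
  rw [intervalIntegral.integral_add (iK₂.add (iK₁.const_mul _)) iK,
    intervalIntegral.integral_add iK₂ (iK₁.const_mul _),
    intervalIntegral.integral_const_mul] at hint
  have e0 : nicholsonIntegral α w z = ∫ ζ in (0 : ℝ)..Real.log (z / w), K z ζ := rfl
  have e1 : nicholsonIntegralDeriv α w z = (∫ ζ in (0 : ℝ)..Real.log (z / w), K₁ z ζ) +
    ((z ^ 2 - w ^ 2) / (2 * z * w)) ^ (2 * α) / z := rfl
  have hpow : (2 * α : ℝ) * ((z ^ 2 - w ^ 2) / (2 * z * w)) ^ (2 * α) =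
      2 * α * ((z ^ 2 - w ^ 2) / (2 * z * w)) ^ (2 * α - 1) *
        ((z ^ 2 - w ^ 2) / (2 * z * w)) := by
    rcases α with _ | a
    · simp
    · rw [mul_assoc _ _ ((z ^ 2 - w ^ 2) / (2 * z * w)), ← pow_succ,
        Nat.sub_add_cancel (by omega)]
  rw [e0, e1]
  simp only [hM, Real.sinh_zero, coshDistSq_log hz0 hw, seriesSum_zero, sinh_log_div hz0 hw,
    pow_succ _ (2 * α), mul_zero, zero_mul, sub_zero] at hint
  have hK₁L : K₁ z (Real.log (z / w)) = derivCoeff (uCoeff α) 0 * (2 * z - (z ^ 2 + w ^ 2) / z) *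
      ((z ^ 2 - w ^ 2) / (2 * z * w)) ^ (2 * α) := by
    simp only [hK₁, coshDistSq_log hz0 hw, seriesSum_zero, sinh_log_div hz0 hw,
      cosh_log_div hz0 hw]
    field_simp
  rw [hK₁L]
  simp only [Pi.pow_apply]
  generalize ((z ^ 2 - w ^ 2) / (2 * z * w)) ^ (2 * α) = X at *
  generalize ((z ^ 2 - w ^ 2) / (2 * z * w)) ^ (2 * α - 1) = Y at *
  generalize (∫ ζ in (0 : ℝ)..Real.log (z / w), K z ζ) = A at *
  generalize (∫ ζ in (0 : ℝ)..Real.log (z / w), K₁ z ζ) = B at *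
  generalize (∫ ζ in (0 : ℝ)..Real.log (z / w), K₂ z ζ) = C at *
  generalize derivCoeff (uCoeff α) 0 = d at *
  push_cast
  have hA : A = -2 * w / z * (X * ((z ^ 2 - w ^ 2) / (2 * z * w)) * d) -
    C - (2 * α + 1) / z * B := by linarith
  rw [hA]
  field_simp at hpow ⊢
  ring_nf at hpow ⊢
  linear_combination hpow

theorem choose_succ_mul (n k : ℕ) :
    (n.choose (k + 1) : ℝ) * (k + 1) = n.choose k * ((n : ℝ) - k) := by
  rcases le_or_gt k n with h | h
  · have := Nat.choose_succ_right_eq n k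
    rw [← Nat.cast_sub h]
    exact_mod_cast this
  · simp [Nat.choose_eq_zero_of_lt h, Nat.choose_eq_zero_of_lt (Nat.lt_succ_of_lt h)]

theorem succ_choose_mul (n k : ℕ) :
    ((n + 1).choose k : ℝ) * ((n : ℝ) + 1 - k) = n.choose k * (n + 1) := by
  rcases le_or_gt k (n + 1) with h | h
  · have := Nat.choose_mul_succ_eq n k
    rw [← Nat.cast_succ, ← Nat.cast_sub h]
    exact_mod_cast this.symm
  · simp [Nat.choose_eq_zero_of_lt h, Nat.choose_eq_zero_of_lt (Nat.lt_of_succ_lt h)]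

/-- The telescoping identity behind the recursion for the polynomials `nicholsonPoly`. -/
theorem sum_choose_mul_telescope {a D M : ℝ} (hD : D ≠ 0) (hM : M ≠ 0) (j : ℕ) {t : ℕ → ℝ}
    (ht : ∀ q ≤ j, (q + 1) * t (q + 1) = 2 * (2 * a - 2 * q - 1) * (M ^ 2 / D ^ 2) * t q) :
    ∑ q ∈ Finset.range (j + 1), (q.choose (j - q) : ℝ) * t q *
      ((2 * a - 2 * q - 1) * (q - j) / D + (2 * q - j) * (2 * q - j - 1) * D / (2 * M ^ 2) +
        (2 * q - j) * (a - q - (j + 1) / 2) / M +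
        (2 * a - 2 * q - 1) * (2 * a - 2 * q - 2) * M / (2 * D ^ 2)) =
    (a - 1 - j) * (j + 1) / (2 * M) *
      ∑ q ∈ Finset.range (j + 2), (q.choose (j + 1 - q) : ℝ) * t q := by
  have ht' : ∀ q ≤ j, t (q + 1) = 2 * (2 * a - 2 * q - 1) * (M ^ 2 / D ^ 2) * t q / (q + 1) :=
    fun q hq => by rw [← ht q hq]; field_simp
  have h₁ : ∑ q ∈ Finset.range (j + 1),
        (q.choose (j - q) : ℝ) * t q * ((2 * q - j) * (2 * q - j - 1) * D / (2 * M ^ 2)) =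
      ∑ q ∈ Finset.range (j + 1),
        (q.choose (j - q) : ℝ) * t q * ((2 * a - 2 * q - 1) * (j - q) / D) := by
    rw [Finset.sum_range_succ', Finset.sum_range_succ]
    congr 1
    · refine Finset.sum_congr rfl fun q hq => ?_
      obtain ⟨k, rfl⟩ : ∃ k, j = q + (k + 1) :=
        ⟨j - q - 1, by have := Finset.mem_range.1 hq; omega⟩
      have e₁ := succ_choose_mul q k
      have e₂ := choose_succ_mul q k
      rw [ht' q (by omega), show q + (k + 1) - (q + 1) = k by omega, Nat.add_sub_cancel_left]
      push_cast
      field_simp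
      linear_combination (2 * (a - q) - 1) * t q * (q - k) * e₁ -
        (2 * (a - q) - 1) * t q * (q + 1) * e₂
    · rcases j with _ | j <;> simp
  have h₂ : ∑ q ∈ Finset.range (j + 1), (q.choose (j - q) : ℝ) * t q *
        ((2 * a - 2 * q - 1) * (2 * a - 2 * q - 2) * M / (2 * D ^ 2)) =
      ∑ q ∈ Finset.range (j + 2),
        (q.choose (j + 1 - q) : ℝ) * t q * ((2 * q - j - 1) * (a - q) / (2 * M)) := by
    rw [Finset.sum_range_succ' _ (j + 1)]
    simp only [Nat.sub_zero, Nat.choose_zero_succ, Nat.cast_zero, zero_mul, add_zero]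
    refine Finset.sum_congr rfl fun q hq => ?_
    obtain ⟨k, rfl⟩ := Nat.exists_eq_add_of_le (Nat.lt_succ_iff.1 (Finset.mem_range.1 hq))
    have e₁ := succ_choose_mul q k
    rw [ht' q (by omega), show q + k + 1 - (q + 1) = k by omega, Nat.add_sub_cancel_left]
    push_cast
    field_simp
    linear_combination -(2 * (a - q) - 1) * t q * (a - q - 1) * e₁
  have h₃ : ∑ q ∈ Finset.range (j + 1), (q.choose (j - q) : ℝ) * t q *
        ((2 * q - j) * (a - q - (j + 1) / 2) / M) +
      ∑ q ∈ Finset.range (j + 2),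
        (q.choose (j + 1 - q) : ℝ) * t q * ((2 * q - j - 1) * (a - q) / (2 * M)) =
      (a - 1 - j) * (j + 1) / (2 * M) *
        ∑ q ∈ Finset.range (j + 2), (q.choose (j + 1 - q) : ℝ) * t q := by
    rw [Finset.sum_range_succ _ (j + 1), Finset.sum_range_succ _ (j + 1), ← add_assoc,
      ← Finset.sum_add_distrib, mul_add, Finset.mul_sum]
    congr 1
    · refine Finset.sum_congr rfl fun q hq => ?_
      obtain ⟨k, rfl⟩ := Nat.exists_eq_add_of_le (Nat.lt_succ_iff.1 (Finset.mem_range.1 hq))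
      have e₂ := choose_succ_mul q k
      rw [Nat.add_sub_cancel_left, show q + k + 1 - q = k + 1 by omega]
      push_cast
      field_simp
      linear_combination -t q * (2 * (a - q) - (q + k + 1)) * e₂
    · simp only [Nat.sub_self, Nat.choose_zero_right]
      push_cast
      ring
  rw [← h₃, ← h₂, ← Finset.sum_add_distrib]
  simp only [mul_add, Finset.sum_add_distrib]
  rw [h₁, ← Finset.sum_add_distrib]
  have : ∀ q : ℕ, (q.choose (j - q) : ℝ) * t q * ((2 * a - 2 * q - 1) * (q - j) / D) +
      (q.choose (j - q) : ℝ) * t q * ((2 * a - 2 * q - 1) * (j - q) / D) = 0 := fun q => by ring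
  simp only [this, Finset.sum_const_zero, zero_add]

/-- The function `(x - y)^a (x + y)^b`. -/
def prodPow (y : ℝ) (a b : ℕ) (x : ℝ) : ℝ := (x - y) ^ a * (x + y) ^ b

/-- The derivative of `prodPow y a b`. -/
def prodPowDeriv (y : ℝ) (a b : ℕ) (x : ℝ) : ℝ :=
  a * prodPow y (a - 1) b x + b * prodPow y a (b - 1) x

/-- The second derivative of `prodPow y a b`. -/
def prodPowDerivTwo (y : ℝ) (a b : ℕ) (x : ℝ) : ℝ :=
  a * prodPowDeriv y (a - 1) b x + b * prodPowDeriv y a (b - 1) x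

theorem hasDerivAt_prodPow (y : ℝ) (a b : ℕ) (x : ℝ) :
    HasDerivAt (prodPow y a b) (prodPowDeriv y a b x) x := by
  refine ((((hasDerivAt_id x).sub_const y).pow a).mul
    (((hasDerivAt_id x).add_const y).pow b)).congr_deriv ?_
  simp only [prodPowDeriv, prodPow, Pi.pow_apply, id]
  ring

theorem hasDerivAt_prodPowDeriv (y : ℝ) (a b : ℕ) (x : ℝ) :
    HasDerivAt (prodPowDeriv y a b) (prodPowDerivTwo y a b x) x :=
  ((hasDerivAt_prodPow y (a - 1) b x).const_mul _).add
    ((hasDerivAt_prodPow y a (b - 1) x).const_mul _)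

theorem natCast_mul_pow_pred {D : ℝ} (hD : D ≠ 0) (n : ℕ) :
    (n : ℝ) * D ^ (n - 1) = n * D ^ n / D := by
  rcases n with _ | n
  · simp
  · rw [Nat.add_sub_cancel, pow_succ]
    field_simp

theorem natCast_mul_pow_pred_pred {D : ℝ} (hD : D ≠ 0) (n : ℕ) :
    (n : ℝ) * (((n - 1 : ℕ) : ℝ) * D ^ (n - 1 - 1)) = n * (n - 1) * D ^ n / D ^ 2 := by
  rw [natCast_mul_pow_pred hD]
  rcases n with _ | n
  · simp
  · rw [Nat.add_sub_cancel, pow_succ]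
    push_cast
    field_simp
    ring

theorem prodPow_operator {x y : ℝ} (hD : x - y ≠ 0) (hM : x + y ≠ 0) (c : ℝ) (a b : ℕ) :
    x * prodPowDerivTwo y a b x + c * prodPowDeriv y a b x = prodPow y a b x *
      (a * ((a - 1) / 2 + b + c) / (x - y) + b * (b - 1) * (x - y) / (2 * (x + y) ^ 2) +
        b * ((b - 1) / 2 + a + c) / (x + y) + a * (a - 1) * (x + y) / (2 * (x - y) ^ 2)) := by
  have a₁ := natCast_mul_pow_pred hD a
  have a₂ := natCast_mul_pow_pred_pred hD a
  have b₁ := natCast_mul_pow_pred hM b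
  have b₂ := natCast_mul_pow_pred_pred hM b
  have e₁ : prodPowDeriv y a b x = prodPow y a b x * (a / (x - y) + b / (x + y)) := by
    simp only [prodPowDeriv, prodPow]
    linear_combination (x + y) ^ b * a₁ + (x - y) ^ a * b₁
  have e₂ : prodPowDerivTwo y a b x = prodPow y a b x * (a * (a - 1) / (x - y) ^ 2 +
      2 * (a * b) / ((x - y) * (x + y)) + b * (b - 1) / (x + y) ^ 2) := by
    simp only [prodPowDerivTwo, prodPowDeriv, prodPow]
    have hab : 2 * (a * b) / ((x - y) * (x + y)) = 2 * (a / (x - y)) * (b / (x + y)) := by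
      field_simp
    rw [hab]
    linear_combination (x + y) ^ b * a₂ + (x - y) ^ a * b₂ +
      2 * (b * (x + y) ^ (b - 1)) * a₁ + 2 * (a * (x - y) ^ a / (x - y)) * b₁
  rw [e₁, e₂]
  obtain ⟨D, rfl⟩ : ∃ D, x = y + D := ⟨x - y, by ring⟩
  simp only [add_sub_cancel_left] at *
  field_simp
  ring

/-- The coefficient `(2α)! (α-q)! / ((2α-2q)! α! q!)`. -/
noncomputable def nicholsonCoeff (α q : ℕ) : ℝ :=
  ((2 * α).factorial * (α - q).factorial : ℝ) /
    ((2 * α - 2 * q).factorial * α.factorial * q.factorial)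

theorem nicholsonCoeff_succ {α q : ℕ} (hq : q < α) :
    (q + 1) * nicholsonCoeff α (q + 1) = 2 * (2 * α - 2 * q - 1) * nicholsonCoeff α q := by
  obtain ⟨m, rfl⟩ := Nat.exists_eq_add_of_lt hq
  simp only [nicholsonCoeff]
  rw [show q + m + 1 - q = m + 1 by omega, show q + m + 1 - (q + 1) = m by omega,
    show 2 * (q + m + 1) - 2 * q = 2 * m + 1 + 1 by omega,
    show 2 * (q + m + 1) - 2 * (q + 1) = 2 * m by omega,
    Nat.factorial_succ m, Nat.factorial_succ (2 * m + 1), Nat.factorial_succ (2 * m),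
    Nat.factorial_succ q]
  push_cast
  field_simp
  ring

theorem nicholsonCoeff_ne_zero (α q : ℕ) : nicholsonCoeff α q ≠ 0 := by
  unfold nicholsonCoeff
  positivity

/-- The polynomial `∑ q, f q * C(q, j-q) * F (2α-2q-1) (2q-j)` in abstract functions `F a b`. -/
noncomputable def nicholsonSum (α j : ℕ) (F : ℕ → ℕ → ℝ) : ℝ :=
  ∑ q ∈ Finset.range (j + 1),
    nicholsonCoeff α q * q.choose (j - q) * F (2 * α - 2 * q - 1) (2 * q - j)

theorem hasDerivAt_nicholsonSum (α j : ℕ) {F F' : ℕ → ℕ → ℝ → ℝ} {x : ℝ}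
    (h : ∀ a b, HasDerivAt (F a b) (F' a b x) x) :
    HasDerivAt (fun x => nicholsonSum α j fun a b => F a b x)
      (nicholsonSum α j fun a b => F' a b x) x :=
  HasDerivAt.fun_sum fun _ _ => (h _ _).const_mul _

theorem nicholsonSum_operator {α j : ℕ} (hj : j < α) {x y : ℝ} (hD : x - y ≠ 0)
    (hM : x + y ≠ 0) :
    x * nicholsonSum α j (fun a b => prodPowDerivTwo y a b x) +
        (1 - α) * nicholsonSum α j (fun a b => prodPowDeriv y a b x) =
      (α - 1 - j) * (j + 1) / 2 * nicholsonSum α (j + 1) (fun a b => prodPow y a b x) := by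
  set t : ℕ → ℝ := fun q => nicholsonCoeff α q *
    ((x - y) ^ (2 * α) / (x - y) ^ (2 * q + 1)) * (x + y) ^ (2 * q) / (x + y) ^ j with ht
  have htr : ∀ q ≤ j, (q + 1) * t (q + 1) =
      2 * (2 * (α : ℝ) - 2 * q - 1) * ((x + y) ^ 2 / (x - y) ^ 2) * t q := by
    intro q hq
    have := nicholsonCoeff_succ (hq.trans_lt hj)
    simp only [ht]
    rw [show 2 * (q + 1) + 1 = 2 * q + 1 + 2 by ring, show 2 * (q + 1) = 2 * q + 2 by ring,
      pow_add _ (2 * q + 1) 2, pow_add _ (2 * q) 2]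
    generalize x - y = D
    generalize x + y = M
    linear_combination D ^ (2 * α) / (D ^ (2 * q + 1) * D ^ 2) * (M ^ (2 * q) * M ^ 2) / M ^ j *
      this
  have hterm : ∀ i q : ℕ, q < α → nicholsonCoeff α q * q.choose (i - q) *
      prodPow y (2 * α - 2 * q - 1) (2 * q - i) x =
      (x + y) ^ j / (x + y) ^ i * (q.choose (i - q) * t q) := by
    intro i q hq
    rcases le_or_gt i (2 * q) with h | h
    · have e₁ : (x - y) ^ (2 * α) / (x - y) ^ (2 * q + 1) = (x - y) ^ (2 * α - 2 * q - 1) := by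
        rw [div_eq_iff (pow_ne_zero _ hD), ← pow_add]
        congr 1
        omega
      have e₂ : (x + y) ^ (2 * q) / (x + y) ^ i = (x + y) ^ (2 * q - i) := by
        rw [div_eq_iff (pow_ne_zero _ hM), ← pow_add, Nat.sub_add_cancel h]
      simp only [ht, prodPow, ← e₁, ← e₂]
      field_simp
    · simp [Nat.choose_eq_zero_of_lt (show q < i - q by omega)]
  have hL : x * nicholsonSum α j (fun a b => prodPowDerivTwo y a b x) +
        (1 - α) * nicholsonSum α j (fun a b => prodPowDeriv y a b x) =
      ∑ q ∈ Finset.range (j + 1), (q.choose (j - q) : ℝ) * t q *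
      ((2 * α - 2 * q - 1) * (q - j) / (x - y) +
        (2 * q - j) * (2 * q - j - 1) * (x - y) / (2 * (x + y) ^ 2) +
        (2 * q - j) * (α - q - (j + 1) / 2) / (x + y) +
        (2 * α - 2 * q - 1) * (2 * α - 2 * q - 2) * (x + y) / (2 * (x - y) ^ 2)) := by
    simp only [nicholsonSum, Finset.mul_sum, ← Finset.sum_add_distrib]
    refine Finset.sum_congr rfl fun q hq => ?_
    have hqj : q ≤ j := Nat.lt_succ_iff.1 (Finset.mem_range.1 hq)
    rcases le_or_gt j (2 * q) with h | h
    · have h₁ := hterm j q (hqj.trans_lt hj)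
      have h₂ := prodPow_operator hD hM (1 - (α : ℝ)) (2 * α - 2 * q - 1) (2 * q - j)
      have ca : ((2 * α - 2 * q - 1 : ℕ) : ℝ) = 2 * α - 2 * q - 1 := by
        rw [Nat.cast_sub (by omega), Nat.cast_sub (by omega)]
        push_cast
        ring
      have cb : ((2 * q - j : ℕ) : ℝ) = 2 * q - j := by
        rw [Nat.cast_sub h]
        push_cast
        ring
      rw [div_self (pow_ne_zero _ hM), one_mul] at h₁
      rw [← h₁]
      rw [ca, cb] at h₂
      linear_combination (nicholsonCoeff α q * q.choose (j - q)) * h₂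
    · simp [Nat.choose_eq_zero_of_lt (show q < j - q by omega)]
  rw [hL, sum_choose_mul_telescope hD hM j htr]
  rcases (Nat.succ_le_iff.2 hj).eq_or_lt with h | h
  · have : (α : ℝ) - 1 - j = 0 := by
      rw [← h]
      push_cast
      ring
    simp [this]
  · rw [nicholsonSum, Finset.sum_congr rfl fun q hq => hterm (j + 1) q
      (by have := Finset.mem_range.1 hq; omega), ← Finset.mul_sum]
    field_simp
    ring

theorem nicholsonT_eq {α j : ℕ} (hj : j < α) (z w : ℝ) :
    nicholsonT α j z w = (-1) ^ j * j.factorial *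
      nicholsonSum α j (fun a b => prodPow (w ^ 2) a b (z ^ 2)) / (z ^ (2 * α) * w ^ (2 * α)) := by
  have hsub : Finset.Icc ((j + 1) / 2) j ⊆ Finset.range (j + 1) := fun q hq =>
    Finset.mem_range.2 (Nat.lt_succ_of_le (Finset.mem_Icc.1 hq).2)
  rw [nicholsonT, nicholsonSum, ← Finset.sum_subset hsub fun q hq hq' => by
    simp only [Finset.mem_range, Finset.mem_Icc] at hq hq'
    simp [Nat.choose_eq_zero_of_lt (show q < j - q by omega)],
    Finset.mul_sum, Finset.sum_div]
  refine Finset.sum_congr rfl fun q hq => ?_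
  obtain ⟨hq, hqj⟩ := Finset.mem_Icc.1 hq
  have hbin : prodPow (w ^ 2) (2 * α - 2 * q - 1) (2 * q - j) (z ^ 2) =
      ∑ r ∈ Finset.range (2 * q - j + 1), ((2 * q - j).choose r : ℝ) * 2 ^ r * w ^ (2 * r) *
        (z ^ 2 - w ^ 2) ^ (2 * α - j - r - 1) := by
    rw [prodPow, show z ^ 2 + w ^ 2 = 2 * w ^ 2 + (z ^ 2 - w ^ 2) by ring, add_pow,
      Finset.mul_sum]
    refine Finset.sum_congr rfl fun r hr => ?_
    have hr := Finset.mem_range.1 hr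
    rw [show 2 * α - j - r - 1 = (2 * α - 2 * q - 1) + (2 * q - j - r) by omega, pow_add,
      mul_pow, ← pow_mul]
    ring
  rw [hbin, Finset.mul_sum, Finset.mul_sum, Finset.sum_div]
  refine Finset.sum_congr rfl fun r _ => ?_
  rw [nicholsonCoeff, Nat.cast_choose ℝ (show j - q ≤ q by omega),
    show q - (j - q) = 2 * q - j by omega]
  field_simp

/-- The polynomial in `z ^ 2` underlying `nicholsonS`, in abstract functions `F a b`. -/
noncomputable def nicholsonPoly (α : ℕ) (F : ℕ → ℕ → ℝ) : ℝ :=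
  ∑ j ∈ Finset.range α, aCoef α j * ((-1) ^ j * j.factorial * nicholsonSum α j F)

theorem nicholsonS_eq (α : ℕ) (z w : ℝ) :
    nicholsonS α z w = (α / (2 : ℝ) ^ (2 * (α : ℤ) - 2)) / w ^ (2 * α) *
      (nicholsonPoly α (fun a b => prodPow (w ^ 2) a b (z ^ 2)) / z ^ (2 * α)) := by
  rw [nicholsonS, Finset.sum_congr rfl fun j hj => by
    rw [nicholsonT_eq (Finset.mem_range.1 hj), ← mul_div_assoc], ← Finset.sum_div,
    ← nicholsonPoly]
  ring

theorem hasDerivAt_nicholsonPoly (α : ℕ) {F F' : ℕ → ℕ → ℝ → ℝ} {x : ℝ}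
    (h : ∀ a b, HasDerivAt (F a b) (F' a b x) x) :
    HasDerivAt (fun x => nicholsonPoly α fun a b => F a b x)
      (nicholsonPoly α fun a b => F' a b x) x :=
  HasDerivAt.fun_sum fun _ _ => ((hasDerivAt_nicholsonSum α _ h).const_mul _).const_mul _

theorem nicholsonPoly_operator {α : ℕ} (hα : 0 < α) {x y : ℝ} (hD : x - y ≠ 0)
    (hM : x + y ≠ 0) :
    4 * (x * nicholsonPoly α (fun a b => prodPowDerivTwo y a b x) +
        (1 - α) * nicholsonPoly α (fun a b => prodPowDeriv y a b x)) +
      nicholsonPoly α (fun a b => prodPow y a b x) = (x - y) ^ (2 * α - 1) := by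
  set G : ℕ → ℝ := fun j => aCoef α j * ((-1) ^ j * j.factorial *
    nicholsonSum α j (fun a b => prodPow y a b x)) with hG
  have h0 : G 0 = (x - y) ^ (2 * α - 1) := by
    have : nicholsonCoeff α 0 = 1 := by
      simp only [nicholsonCoeff, Nat.sub_zero, mul_zero, Nat.factorial_zero, Nat.cast_one, mul_one]
      exact div_self (by positivity)
    simp [hG, aCoef, nicholsonSum, prodPow, this]
  have hα' : G α = 0 := by
    obtain ⟨n, rfl⟩ := Nat.exists_eq_succ_of_ne_zero hα.ne'
    simp [hG, aCoef]
  calc _ = ∑ j ∈ Finset.range α, (G j - G (j + 1)) := by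
        simp only [nicholsonPoly, Finset.mul_sum, ← Finset.sum_add_distrib]
        refine Finset.sum_congr rfl fun j hj => ?_
        have := nicholsonSum_operator (Finset.mem_range.1 hj) hD hM
        simp only [hG, aCoef, Nat.factorial_succ]
        push_cast
        linear_combination 4 * aCoef α j * (-1) ^ j * j.factorial * this
    _ = _ := by rw [Finset.sum_range_sub', h0, hα', sub_zero]

theorem nicholsonPoly_prodPow_self (α : ℕ) (y : ℝ) :
    nicholsonPoly α (fun a b => prodPow y a b y) = 0 := by
  refine Finset.sum_eq_zero fun j hj => ?_
  have hj := Finset.mem_range.1 hj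
  rw [nicholsonSum, Finset.sum_eq_zero, mul_zero, mul_zero]
  intro q hq
  have hq := Finset.mem_range.1 hq
  simp [prodPow, show 2 * α - 2 * q - 1 ≠ 0 by omega]

theorem nicholsonPoly_prodPowDeriv_self (n : ℕ) (y : ℝ) :
    nicholsonPoly (n + 1) (fun a b => prodPowDeriv y a b y) =
      aCoef (n + 1) n * ((-1) ^ n * n.factorial * (nicholsonCoeff (n + 1) n * (2 * y) ^ n)) := by
  have hz : ∀ q b : ℕ, q < n → prodPowDeriv y (2 * (n + 1) - 2 * q - 1) b y = 0 := by
    intro q b hq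
    simp [prodPowDeriv, prodPow, show 2 * (n + 1) - 2 * q - 1 ≠ 0 by omega,
      show 2 * (n + 1) - 2 * q - 1 - 1 ≠ 0 by omega]
  rw [nicholsonPoly, Finset.sum_range_succ, Finset.sum_eq_zero, zero_add, nicholsonSum,
    Finset.sum_range_succ, Finset.sum_eq_zero, zero_add]
  · rw [show 2 * (n + 1) - 2 * n - 1 = 1 by omega, show 2 * n - n = n by omega]
    simp [prodPowDeriv, prodPow, two_mul]
  · intro q hq
    rw [hz q _ (Finset.mem_range.1 hq), mul_zero]
  · intro j hj
    have hj := Finset.mem_range.1 hj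
    rw [nicholsonSum, Finset.sum_eq_zero, mul_zero, mul_zero]
    intro q hq
    rw [hz q _ (by have := Finset.mem_range.1 hq; omega), mul_zero]

theorem aCoef_ne_zero {α j : ℕ} (hj : j < α) : aCoef α j ≠ 0 := by
  induction j with
  | zero => simp [aCoef]
  | succ j ih =>
    have : ((j + 1 : ℕ) : ℝ) < α := Nat.cast_lt.2 hj
    push_cast at this
    rw [aCoef]
    exact mul_ne_zero (mul_ne_zero two_ne_zero (sub_pos.2 this).ne') (ih (by omega))

theorem nicholsonIntegral_self (α : ℕ) {w : ℝ} (hw : 0 < w) : nicholsonIntegral α w w = 0 := by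
  simp [nicholsonIntegral, div_self hw.ne']

theorem nicholsonIntegralDeriv_self (α : ℕ) {w : ℝ} (hw : 0 < w) :
    nicholsonIntegralDeriv α w w = 0 ^ (2 * α) / w := by
  simp [nicholsonIntegralDeriv, div_self hw.ne']

/-- The left-hand side of the Nicholson-type formula solves the homogeneous Bessel equation,
vanishes at `w`, and its derivative there is a multiple of `1 / w ^ (2 * α + 1)`. -/
theorem exists_solvesBessel_nicholson (α : ℕ) : ∃ κ : ℝ, κ ≠ 0 ∧ ∀ w : ℝ, 0 < w →
    ∃ f₁ g : ℝ → ℝ,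
      SolvesBessel α w (fun z => nicholsonIntegral α w z - nicholsonS α z w) f₁ g ∧
      (∀ z, w < z → g z = 0) ∧ nicholsonIntegral α w w - nicholsonS α w w = 0 ∧
      f₁ w = κ / w ^ (2 * α + 1) := by
  rcases α with _ | n
  · refine ⟨1, one_ne_zero, fun w hw => ?_⟩
    have hS : ∀ z, nicholsonS 0 z w = 0 := fun z => by simp [nicholsonS]
    simp only [hS, sub_zero]
    exact ⟨_, _, solvesBessel_nicholsonIntegral 0 hw, by simp, nicholsonIntegral_self 0 hw,
      by simp [nicholsonIntegralDeriv_self 0 hw]⟩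
  set c : ℝ := aCoef (n + 1) n * ((-1) ^ n * n.factorial * nicholsonCoeff (n + 1) n) with hc
  have hc0 : c ≠ 0 := mul_ne_zero (aCoef_ne_zero n.lt_succ_self)
    (mul_ne_zero (by positivity) (nicholsonCoeff_ne_zero _ _))
  refine ⟨-(2 * (n + 1) / 2 ^ n * c), neg_ne_zero.2 (mul_ne_zero (by positivity) hc0),
    fun w hw => ?_⟩
  have hpow : (2 : ℝ) ^ (2 * ((n + 1 : ℕ) : ℤ) - 2) = 2 ^ n * 2 ^ n := by
    rw [show 2 * ((n + 1 : ℕ) : ℤ) - 2 = ((n + n : ℕ) : ℤ) by push_cast; ring, zpow_natCast,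
      pow_add]
  have hS := (solvesBessel_comp_sq_div (α := n + 1) (q := fun x => (x - w ^ 2) ^ (2 * n + 1)) hw
    (fun x => hasDerivAt_nicholsonPoly (n + 1) fun a b => hasDerivAt_prodPow (w ^ 2) a b x)
    (fun x => hasDerivAt_nicholsonPoly (n + 1) fun a b => hasDerivAt_prodPowDeriv (w ^ 2) a b x)
    (fun x hx => nicholsonPoly_operator n.succ_pos (sub_pos.2 hx).ne'
      (by linarith [pow_pos hw 2]))).const_mul
    (((n + 1 : ℕ) : ℝ) / (2 : ℝ) ^ (2 * ((n + 1 : ℕ) : ℤ) - 2) / w ^ (2 * (n + 1)))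
  simp only [← nicholsonS_eq] at hS
  refine ⟨_, _, (solvesBessel_nicholsonIntegral (n + 1) hw).sub hS, fun z hz => ?_, ?_, ?_⟩
  · have hz0 : 0 < z := hw.trans hz
    simp only [hpow, show 2 * (n + 1) - 1 = 2 * n + 1 by omega, div_pow, mul_pow]
    push_cast
    field_simp
    ring
  · rw [nicholsonIntegral_self _ hw, nicholsonS_eq, nicholsonPoly_prodPow_self]
    simp
  · simp only [nicholsonIntegralDeriv_self _ hw, nicholsonPoly_prodPow_self,
      nicholsonPoly_prodPowDeriv_self, hpow]
    rw [zero_pow (by omega), hc]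
    push_cast
    field_simp
    ring

/-- **Nicholson-type formula** (Theorem `Nicholson-type formula`): there is a nonzero
constant `C(α)` depending only on `α` such that for all `z > w > 0`,
`∫_0^{ln(z/w)} u_α(z²+w²-2zw cosh ζ) sinh^{2α} ζ dζ - S_α(z,w)
  = C(α) (j_α(z) y_α(w) - y_α(z) j_α(w))`. -/
theorem nicholson_type_formula (α : ℕ) :
    ∃ C : ℝ, C ≠ 0 ∧ ∀ z w : ℝ, 0 < w → w < z →
      (∫ ζ in (0 : ℝ)..Real.log (z / w),
          uBessel α (z ^ 2 + w ^ 2 - 2 * z * w * Real.cosh ζ) *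
            Real.sinh ζ ^ (2 * α))
        - nicholsonS α z w
      = C * (besselj α z * bessely α w - bessely α z * besselj α w) := by
  obtain ⟨κ, hκ, h⟩ := exists_solvesBessel_nicholson α
  have hW := besselWronskian_zero_ne α
  refine ⟨-κ / besselWronskian α 0, div_ne_zero (neg_ne_zero.2 hκ) hW, fun z w hw hz => ?_⟩
  obtain ⟨f₁, g, hf, hg, h0, h1⟩ := h w hw
  have hjy := (((solvesBessel_besselj α hw).const_mul (bessely α w)).sub
    ((solvesBessel_bessely α hw).const_mul (besselj α w))).const_mul (-κ / besselWronskian α 0)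
  have := (hf.sub hjy).eq_zero (fun z hz => by simp [hg z hz]) hw
    (by rw [h0]; ring)
    (by rw [h1, besselj_bessely_wronskian α hw]; field_simp; ring) hz.le
  rw [uBessel_eq]
  simp only [nicholsonIntegral, coshDistSq] at this
  linear_combination this
end
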